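/- Consider the Gaussian-design regression model y = Xβ^{(n)} + ε with X ∈ ℝ^{n×p_n} having i.i.d. N(0,1) entries independent of ε ~ N(0, I_n), true parameters β^{(n)} ∈ B(p_n, s_n), s_n·log(p_n/s_n)/n → 0 and s_n/p_n → 0. Write ξ* = ξ(β^{(n)}) for the true support and P_ξ for the orthogonal projection onto the column span of X_ξ. Given any positive constants C, M and any ε' > 0, there is a constant C_0 > 0 such that, with probability tending to 1, simultaneously for all ξ_1 ⊆ ξ* with ‖β^{(n)}_{ξ*∖ξ_1}‖ ≤ M·√(s_n·log(p_n/s_n)/n) and all ξ_2 ⊆ (ξ*)^c with 0 < |ξ_2| ≤ C·s_n: y^T(P_{ξ_1∪ξ_2} − P_{ξ_1})y ≤ [C_0·√(s_n²·log²(p_n/s_n)/n) + √((2+ε')·|ξ_2|·log(p_n/|ξ_2|))]². -/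

import Mathlib

open MeasureTheory ProbabilityTheory Filter
open scoped ENNReal

/-- Gaussian random-design regression model: the joint law of `(X, y)` where
`X ∈ ℝ^{n×p}` has i.i.d. `N(0,1)` entries, `ε ~ N(0, I_n)` is independent of
`X`, and `y = Xβ + ε`. -/
noncomputable def gaussDesign (n p : ℕ) (β : Fin p → ℝ) :
    Measure ((Fin n → Fin p → ℝ) × (Fin n → ℝ)) :=
  ((Measure.pi fun _ : Fin n => Measure.pi fun _ : Fin p => gaussianReal 0 1).prod
      (Measure.pi fun _ : Fin n => gaussianReal 0 1)).map
    fun Xe => (Xe.1, fun i => (∑ j, Xe.1 i j * β j) + Xe.2 i)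

/-- `B(p,s)`: vectors in `ℝ^p` with at most `s` nonzero coordinates. -/
def SparseV (p s : ℕ) : Set (Fin p → ℝ) := {β | {j | β j ≠ 0}.ncard ≤ s}

/-- Number of false positives of the estimate `b` when the truth is `β`. -/
noncomputable def FPc {p : ℕ} (b β : Fin p → ℝ) : ℕ :=
  {j | b j ≠ 0 ∧ β j = 0}.ncard

/-- Number of true positives of the estimate `b` when the truth is `β`. -/
noncomputable def TPc {p : ℕ} (b β : Fin p → ℝ) : ℕ :=
  {j | b j ≠ 0 ∧ β j ≠ 0}.ncard

/-- Expected number of false positives `E_β E_X[FP(β̂)]`. -/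
noncomputable def expFPg (n p : ℕ)
    (bh : (Fin n → Fin p → ℝ) × (Fin n → ℝ) → Fin p → ℝ) (β : Fin p → ℝ) : ℝ≥0∞ :=
  ∫⁻ w, (FPc (bh w) β : ℝ≥0∞) ∂(gaussDesign n p β)

/-- `L²` risk `E_β E_X ‖β̂ − β‖²`. -/
noncomputable def l2riskg (n p : ℕ)
    (bh : (Fin n → Fin p → ℝ) × (Fin n → ℝ) → Fin p → ℝ) (β : Fin p → ℝ) : ℝ≥0∞ :=
  ∫⁻ w, ENNReal.ofReal (∑ j, (bh w j - β j) ^ 2) ∂(gaussDesign n p β)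

/-- Membership in `Ω_o(c1)` for the Gaussian-design model: a measurable
estimator whose worst-case risk over `B(p,s)` is at most `c1·s·log(p/s)/n`. -/
def RateMinimaxG (n p s : ℕ) (c1 : ℝ)
    (bh : (Fin n → Fin p → ℝ) × (Fin n → ℝ) → Fin p → ℝ) : Prop :=
  Measurable bh ∧
    ∀ β ∈ SparseV p s,
      l2riskg n p bh β ≤ ENNReal.ofReal (c1 * s * Real.log ((p : ℝ) / s) / n)

/-- Residual sum of squares of the best approximation of `y` using the columns
of `X` in `ξ`; `RSS ξ₁ − RSS (ξ₁ ∪ ξ₂)` equals `yᵀ(P_{ξ₁∪ξ₂} − P_{ξ₁})y`,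
where `P_ξ` is the orthogonal projection onto the column span of `X_ξ`. -/
noncomputable def RSS {n p : ℕ} (X : Fin n → Fin p → ℝ) (y : Fin n → ℝ)
    (ξ : Finset (Fin p)) : ℝ :=
  sInf ((fun θ : Fin p → ℝ => ∑ i, (y i - ∑ j, X i j * θ j) ^ 2) ''
    {θ | ∀ j ∉ ξ, θ j = 0})

/-- The support of `β` as a finset. -/
noncomputable def suppF {p : ℕ} (β : Fin p → ℝ) : Finset (Fin p) :=
  (Set.toFinite {j | β j ≠ 0}).toFinset

section Deterministic

open scoped RealInnerProductSpace

variable {E F : Type*} [NormedAddCommGroup E] [InnerProductSpace ℝ E]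
  [NormedAddCommGroup F] [InnerProductSpace ℝ F]

/-- If `A` is a near multiple of an isometry on the pair of orthogonal vectors `±c + u`, then the
images of `c` and `u` are nearly orthogonal. -/
lemma inner_map_le_of_restricted_isometry (A : E →ₗ[ℝ] F) {n δ : ℝ}
    {Vs V2 : Submodule ℝ E} (hort : ∀ v ∈ Vs, ∀ u ∈ V2, ⟪v, u⟫ = 0)
    (hrip : ∀ v ∈ Vs, ∀ u ∈ V2,
      |‖A (v + u)‖ ^ 2 - n * ‖v + u‖ ^ 2| ≤ n * δ * ‖v + u‖ ^ 2)
    {c u : E} (hc : c ∈ Vs) (hu : u ∈ V2) :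
    ⟪A c, A u⟫ ≤ n * δ * ‖c‖ * ‖u‖ := by
  have key : ∀ c ∈ Vs, ∀ u ∈ V2, ⟪A c, A u⟫ ≤ n * δ * (‖c‖ ^ 2 + ‖u‖ ^ 2) / 2 := by
    intro c hc u hu
    have h1 := (abs_le.1 (hrip c hc u hu)).2
    have h2 := (abs_le.1 (hrip c hc (-u) (V2.neg_mem hu))).1
    have h3 := hort c hc u hu
    rw [map_add, norm_add_sq_real, norm_add_sq_real, h3] at h1
    rw [map_add, norm_add_sq_real, norm_add_sq_real, map_neg, inner_neg_right, inner_neg_right,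
      norm_neg, norm_neg, h3] at h2
    nlinarith
  rcases eq_or_ne c 0 with rfl | hc0
  · simp
  rcases eq_or_ne u 0 with rfl | hu0
  · simp
  have hc1 : 0 < ‖c‖ := norm_pos_iff.2 hc0
  have hu1 : 0 < ‖u‖ := norm_pos_iff.2 hu0
  have h := key (‖u‖ • c) (Vs.smul_mem _ hc) (‖c‖ • u) (V2.smul_mem _ hu)
  rw [map_smul, map_smul, inner_smul_left, inner_smul_right, norm_smul, norm_smul] at h
  simp only [norm_norm, conj_trivial] at h
  have h' : ‖u‖ * ‖c‖ * ⟪A c, A u⟫ ≤ ‖u‖ * ‖c‖ * (n * δ * ‖c‖ * ‖u‖) := by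
    nlinarith
  exact le_of_mul_le_mul_left h' (by positivity)

/-- Deterministic bound for the decrease of the residual sum of squares when the model `V1` is
enlarged by `V2`, under a restricted isometry property. -/
lemma exists_rss_difference_le [FiniteDimensional ℝ E] (A : E →ₗ[ℝ] F) {n δ κ : ℝ}
    (hδ0 : 0 ≤ δ) (hn : 0 ≤ n) (hκ : 0 < κ) (hκ2 : κ ^ 2 = n * (1 - δ))
    {V1 Vs V2 : Submodule ℝ E} (hV : V1 ≤ Vs) (hort : ∀ v ∈ Vs, ∀ u ∈ V2, ⟪v, u⟫ = 0)
    (hrip : ∀ v ∈ Vs, ∀ u ∈ V2,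
      |‖A (v + u)‖ ^ 2 - n * ‖v + u‖ ^ 2| ≤ n * δ * ‖v + u‖ ^ 2)
    {e : F} {gs g2 R : ℝ} (hgs0 : 0 ≤ gs) (hg20 : 0 ≤ g2)
    (hgs : ∀ d ∈ Vs, ⟪e, A d⟫ ≤ gs * ‖d‖) (hg2 : ∀ u ∈ V2, ⟪e, A u⟫ ≤ g2 * ‖u‖)
    {b1 br : E} (hb1 : b1 ∈ V1) (hbr : br ∈ Vs) (hR : ‖A br‖ ≤ R)
    {a u : E} (ha : a ∈ V1) (hu : u ∈ V2) :
    ∃ b ∈ V1, ‖A (b1 + br) + e - A b‖ ^ 2 - ‖A (b1 + br) + e - A (a + u)‖ ^ 2 ≤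
      ((g2 + n * δ * ((R + gs / κ) / κ)) / κ) ^ 2 := by
  have hlow : ∀ v ∈ Vs, ∀ u ∈ V2, κ * ‖v + u‖ ≤ ‖A (v + u)‖ := by
    intro v hv u hu
    have h := (abs_le.1 (hrip v hv u hu)).1
    refine le_of_sq_le_sq ?_ (norm_nonneg _)
    rw [mul_pow, hκ2]
    linarith
  have hlow' : ∀ v ∈ Vs, κ * ‖v‖ ≤ ‖A v‖ := by
    intro v hv
    simpa using hlow v hv 0 V2.zero_mem
  set W : Submodule ℝ F := V1.map A with hW
  have hproj : ∀ z : F, ∃ b ∈ V1, A b = W.starProjection z := by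
    intro z
    obtain ⟨b, hb, h⟩ := Submodule.mem_map.1 (W.starProjection_apply_mem z)
    exact ⟨b, hb, h⟩
  have horth : ∀ z : F, ∀ b ∈ V1, ⟪z - W.starProjection z, A b⟫ = 0 := by
    intro z b hb
    exact W.starProjection_inner_eq_zero z (A b) (Submodule.mem_map_of_mem hb)
  obtain ⟨b0, hb0, hb0'⟩ := hproj (A (b1 + br) + e)
  obtain ⟨bu, hbu, hbu'⟩ := hproj (A u)
  obtain ⟨d, hd, hd'⟩ := hproj e
  obtain ⟨f, hf, hf'⟩ := hproj (A br)
  refine ⟨b0, hb0, ?_⟩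
  have hq : ∀ b ∈ V1, ⟪A (b1 + br) + e - A b0, A b⟫ = 0 := by
    rw [hb0']; exact horth _
  have hh : ∀ b ∈ V1, ⟪A u - A bu, A b⟫ = 0 := by
    rw [hbu']; exact horth _
  set q := A (b1 + br) + e - A b0 with hqdef
  set h := A u - A bu with hhdef
  have hc : b1 + br - b0 ∈ Vs := Vs.sub_mem (Vs.add_mem (hV hb1) hbr) (hV hb0)
  set c := b1 + br - b0 with hcdef
  have hqc : q = A c + e := by
    rw [hqdef, hcdef, map_sub]; abel
  -- the projection of the noise
  have hdn : ‖A d‖ ≤ gs / κ := by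
    have h1 : ‖A d‖ ^ 2 = ⟪e, A d⟫ := by
      have := horth e d hd
      rw [← hd', inner_sub_left, real_inner_self_eq_norm_sq] at this
      linarith
    have h2 := hgs d (hV hd)
    have h3 := hlow' d (hV hd)
    rw [le_div_iff₀ hκ]
    rcases (norm_nonneg (A d)).eq_or_lt with h0 | h0
    · rw [← h0]; simpa using hgs0
    · refine le_of_mul_le_mul_left ?_ h0
      nlinarith [mul_le_mul_of_nonneg_left h3 hgs0]
  have hAc : A c = (A br - A f) - A d := by
    have h1 : W.starProjection (A b1) = A b1 :=
      Submodule.starProjection_eq_self_iff.2 (Submodule.mem_map_of_mem hb1)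
    have h2 : A b0 = A b1 + A f + A d := by
      rw [hb0', map_add A b1 br, map_add, map_add, h1, hf', hd']
    rw [hcdef, map_sub, map_add, h2]; abel
  have hfn : ‖A br - A f‖ ≤ ‖A br‖ := by
    have h1 := horth (A br) f hf
    rw [← hf'] at h1
    have h2 : ‖A br‖ ^ 2 = ‖A br - A f‖ ^ 2 + ‖A f‖ ^ 2 := by
      have := norm_add_sq_real (A br - A f) (A f)
      rw [h1, sub_add_cancel] at this
      linarith
    refine le_of_sq_le_sq ?_ (norm_nonneg _)
    nlinarith [sq_nonneg ‖A f‖]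
  have hcn : ‖c‖ ≤ (R + gs / κ) / κ := by
    rw [le_div_iff₀ hκ, mul_comm]
    calc κ * ‖c‖ ≤ ‖A c‖ := hlow' c hc
      _ ≤ ‖A br - A f‖ + ‖A d‖ := by rw [hAc]; exact norm_sub_le _ _
      _ ≤ R + gs / κ := by linarith
  set G := g2 + n * δ * ((R + gs / κ) / κ) with hG
  have hR0 : 0 ≤ R := (norm_nonneg _).trans hR
  have hG0 : 0 ≤ G := by positivity
  have hqu : ⟪q, A u⟫ ≤ G * ‖u‖ := by
    rw [hqc, inner_add_left]
    have h1 := inner_map_le_of_restricted_isometry A hort hrip hc hu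
    have h2 := hg2 u hu
    have h3 : n * δ * ‖c‖ * ‖u‖ ≤ n * δ * ((R + gs / κ) / κ) * ‖u‖ := by gcongr
    rw [hG]
    linarith
  have hun : κ * ‖u‖ ≤ ‖h‖ := by
    have h1 := hlow (-bu) (Vs.neg_mem (hV hbu)) u hu
    have h2 : ‖u‖ ≤ ‖-bu + u‖ := by
      refine le_of_sq_le_sq ?_ (norm_nonneg _)
      rw [norm_add_sq_real, hort _ (Vs.neg_mem (hV hbu)) u hu]
      nlinarith [sq_nonneg ‖-bu‖]
    have h3 : A (-bu + u) = h := by rw [hhdef, map_add, map_neg]; abel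
    rw [h3] at h1
    exact (mul_le_mul_of_nonneg_left h2 hκ.le).trans h1
  have hqh : ⟪q, h⟫ ≤ G / κ * ‖h‖ := by
    have h1 : ⟪q, h⟫ = ⟪q, A u⟫ := by
      rw [hhdef, inner_sub_right, hq bu hbu, sub_zero]
    rw [h1]
    refine hqu.trans ?_
    rw [div_mul_eq_mul_div, le_div_iff₀ hκ]
    nlinarith [mul_le_mul_of_nonneg_left hun hG0]
  have hres : ‖q - h‖ ^ 2 ≤ ‖A (b1 + br) + e - A (a + u)‖ ^ 2 := by
    have h1 : A (b1 + br) + e - A (a + u) = (q - h) + A (b0 - a - bu) := by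
      rw [hqdef, hhdef]; simp only [map_add, map_sub]; abel
    have hm : b0 - a - bu ∈ V1 := V1.sub_mem (V1.sub_mem hb0 ha) hbu
    rw [h1, norm_add_sq_real, inner_sub_left, hq _ hm, hh _ hm]
    nlinarith [sq_nonneg ‖A (b0 - a - bu)‖]
  rw [norm_sub_sq_real] at hres
  nlinarith [sq_nonneg (G / κ - ‖h‖)]

end Deterministic

section Nets

open scoped RealInnerProductSpace

lemma exists_half_net (E : Type*) [NormedAddCommGroup E] [NormedSpace ℝ E]
    [FiniteDimensional ℝ E] :
    ∃ S : Finset E, S.card ≤ 5 ^ Module.finrank ℝ E ∧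
      ∀ u : E, ‖u‖ ≤ 1 → ∃ x ∈ S, ‖u - x‖ ≤ 1 / 2 := by
  classical
  set P : Finset E → Prop := fun S => (∀ c ∈ S, ‖c‖ ≤ 2) ∧
    ∀ c ∈ S, ∀ d ∈ S, c ≠ d → 1 ≤ ‖c - d‖ with hP
  have hcard : ∀ S, P S → S.card ≤ 5 ^ Module.finrank ℝ E :=
    fun S hS => Besicovitch.card_le_of_separated S hS.1 hS.2
  set Q : Set ℕ := {k | ∃ S, P S ∧ S.card = k} with hQ
  have hQne : Q.Nonempty := ⟨0, ∅, by simp [hP], rfl⟩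
  have hQb : BddAbove Q := ⟨_, by rintro _ ⟨S, hS, rfl⟩; exact hcard S hS⟩
  obtain ⟨S, hS, hSc⟩ := Nat.sSup_mem hQne hQb
  refine ⟨S.image fun x => (1 / 2 : ℝ) • x, Finset.card_image_le.trans (hcard S hS), ?_⟩
  intro u hu
  by_contra! hcon
  have hsep : ∀ x ∈ S, 1 < ‖(2 : ℝ) • u - x‖ := by
    intro x hx
    have h1 := hcon _ (Finset.mem_image_of_mem _ hx)
    have h2 : (2 : ℝ) • u - x = (2 : ℝ) • (u - (1 / 2 : ℝ) • x) := by
      rw [smul_sub, smul_smul]; norm_num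
    rw [h2, norm_smul, Real.norm_ofNat]
    linarith
  have hnot : (2 : ℝ) • u ∉ S := fun h => by
    have := hsep _ h
    simp at this
    linarith
  have hins : P (insert ((2 : ℝ) • u) S) := by
    refine ⟨?_, ?_⟩
    · intro c hc
      rcases Finset.mem_insert.1 hc with rfl | hc
      · rw [norm_smul, Real.norm_ofNat]; linarith
      · exact hS.1 c hc
    · intro c hc d hd hcd
      rcases Finset.mem_insert.1 hc with rfl | hc <;> rcases Finset.mem_insert.1 hd with rfl | hd
      · exact absurd rfl hcd
      · exact (hsep d hd).le
      · rw [norm_sub_rev]; exact (hsep c hc).le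
      · exact hS.2 c hc d hd hcd
  have := le_csSup hQb ⟨_, hins, rfl⟩
  rw [← hSc, Finset.card_insert_of_notMem hnot] at this
  omega

lemma exists_quarter_net (E : Type*) [NormedAddCommGroup E] [NormedSpace ℝ E]
    [FiniteDimensional ℝ E] :
    ∃ S : Finset E, S.card ≤ 25 ^ Module.finrank ℝ E ∧
      ∀ u : E, ‖u‖ ≤ 1 → ∃ x ∈ S, ‖u - x‖ ≤ 1 / 4 := by
  classical
  obtain ⟨S, hS, hS'⟩ := exists_half_net E
  refine ⟨Finset.image₂ (fun x y => x + (1 / 2 : ℝ) • y) S S, ?_, ?_⟩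
  · refine (Finset.card_image₂_le _ _ _).trans ((Nat.mul_le_mul hS hS).trans ?_)
    rw [← mul_pow]
    norm_num
  · intro u hu
    obtain ⟨x, hx, hux⟩ := hS' u hu
    obtain ⟨y, hy, hxy⟩ := hS' ((2 : ℝ) • (u - x)) (by
      rw [norm_smul, Real.norm_ofNat]; linarith)
    refine ⟨_, Finset.mem_image₂_of_mem hx hy, ?_⟩
    have h : u - (x + (1 / 2 : ℝ) • y) = (1 / 2 : ℝ) • ((2 : ℝ) • (u - x) - y) := by
      rw [smul_sub, smul_smul]; norm_num; abel
    rw [h, norm_smul]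
    norm_num
    linarith

variable {E F : Type*} [NormedAddCommGroup E] [InnerProductSpace ℝ E]
  [NormedAddCommGroup F] [InnerProductSpace ℝ F]

/-- Near-isometry on a `1/4`-net of the unit ball implies near-isometry. -/
lemma near_isometry_of_net [FiniteDimensional ℝ E] (A : E →ₗ[ℝ] F) {n t : ℝ} (hn : 0 ≤ n)
    (ht : 0 ≤ t) {S : Set E} (hS : ∀ u : E, ‖u‖ ≤ 1 → ∃ x ∈ S, ‖u - x‖ ≤ 1 / 4)
    (h : ∀ x ∈ S, |‖A x‖ ^ 2 - n * ‖x‖ ^ 2| ≤ n * t * ‖x‖ ^ 2) (u : E) :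
    |‖A u‖ ^ 2 - n * ‖u‖ ^ 2| ≤ n * (4 * t) * ‖u‖ ^ 2 := by
  set q : E → ℝ := fun u => ‖A u‖ ^ 2 - n * ‖u‖ ^ 2 with hq
  have hA : Continuous A := A.continuous_of_finiteDimensional
  have hqc : Continuous fun u => |q u| := by fun_prop
  obtain ⟨u0, hu0, hmax⟩ := (isCompact_closedBall (0 : E) 1).exists_isMaxOn
    ⟨0, by simp⟩ hqc.continuousOn
  have hu0' : ‖u0‖ ≤ 1 := by simpa using hu0
  set K := |q u0| with hK
  have hK0 : 0 ≤ K := abs_nonneg _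
  have hqsmul : ∀ (r : ℝ) (v : E), q (r • v) = r ^ 2 * q v := by
    intro r v
    simp only [hq, map_smul, norm_smul, Real.norm_eq_abs, mul_pow, sq_abs]; ring
  have hqK : ∀ v, |q v| ≤ K * ‖v‖ ^ 2 := by
    intro v
    rcases eq_or_ne v 0 with rfl | hv
    · simp [hq]
    have hv' : 0 < ‖v‖ := norm_pos_iff.2 hv
    have h1 : |q (‖v‖⁻¹ • v)| ≤ K :=
      hmax (by simp [norm_smul, hv'.ne'])
    rw [hqsmul, abs_mul, abs_of_nonneg (by positivity)] at h1
    rw [inv_pow, inv_mul_le_iff₀ (by positivity)] at h1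
    linarith
  have hqsub : ∀ w v : E, q v - q (v - w) = (q (3 • w + (1 / 3 : ℝ) • (2 • v - w)) -
      q (3 • w - (1 / 3 : ℝ) • (2 • v - w))) / 4 := by
    intro w v
    simp only [hq, map_add, map_sub, map_smul, ← Nat.cast_smul_eq_nsmul ℝ,
      ← real_inner_self_eq_norm_sq, inner_add_left, inner_add_right, inner_sub_left,
      inner_sub_right, inner_smul_left, inner_smul_right, conj_trivial,
      real_inner_comm (A v) (A w), real_inner_comm v w]
    push_cast
    ring
  obtain ⟨x, hx, hux⟩ := hS u0 hu0'
  have hxn : ‖x‖ ≤ 5 / 4 := by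
    have := norm_sub_le u0 (u0 - x)
    rw [sub_sub_cancel] at this
    linarith
  have h1 := hqsub (u0 - x) u0
  rw [sub_sub_cancel] at h1
  set a : E := 3 • (u0 - x)
  set b : E := (1 / 3 : ℝ) • (2 • u0 - (u0 - x))
  have ha : ‖a‖ ≤ 3 / 4 := by
    simp only [a, ← Nat.cast_smul_eq_nsmul ℝ, norm_smul]; norm_num; linarith
  have hb : ‖b‖ ≤ 3 / 4 := by
    have : 2 • u0 - (u0 - x) = u0 + x := by rw [two_nsmul]; abel
    have h2 := norm_add_le u0 x
    simp only [b, norm_smul, this]; norm_num; linarith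
  have h2 := abs_le.1 (hqK (a + b))
  have h3 := abs_le.1 (hqK (a - b))
  have h4 := parallelogram_law_with_norm ℝ a b
  have ha2 : ‖a‖ * ‖a‖ ≤ 9 / 16 := by nlinarith [norm_nonneg a]
  have hb2 : ‖b‖ * ‖b‖ ≤ 9 / 16 := by nlinarith [norm_nonneg b]
  have h5 : K * ‖a + b‖ ^ 2 + K * ‖a - b‖ ^ 2 ≤ K * (9 / 4) := by
    rw [← mul_add]
    gcongr
    nlinarith
  have h6 : |q u0 - q x| ≤ 9 / 16 * K := by
    rw [h1, abs_le]; constructor <;> linarith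
  have h7 : |q x| ≤ n * t * (25 / 16) := by
    refine (h x hx).trans ?_
    gcongr
    nlinarith [norm_nonneg x]
  have h8 : K ≤ n * (4 * t) := by
    have h9 := abs_le.1 h6
    have h10 := abs_le.1 h7
    have h11 : K ≤ 9 / 16 * K + n * t * (25 / 16) := by
      conv_lhs => rw [hK]
      rw [abs_le]; constructor <;> linarith
    nlinarith [mul_nonneg hn ht]
  exact (hqK u).trans (by gcongr)

/-- A finite set of vectors testing near-isometry on a subspace. -/
lemma exists_finset_near_isometry [FiniteDimensional ℝ E] (V : Submodule ℝ E) :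
    ∃ S : Finset E, S.card ≤ 25 ^ Module.finrank ℝ V ∧
      ∀ (A : E →ₗ[ℝ] F) (n t : ℝ), 0 ≤ n → 0 ≤ t →
        (∀ x ∈ S, |‖A x‖ ^ 2 - n * ‖x‖ ^ 2| ≤ n * t * ‖x‖ ^ 2) →
        ∀ u ∈ V, |‖A u‖ ^ 2 - n * ‖u‖ ^ 2| ≤ n * (4 * t) * ‖u‖ ^ 2 := by
  classical
  obtain ⟨S, hS, hS'⟩ := exists_quarter_net V
  refine ⟨S.image V.subtype, Finset.card_image_le.trans hS, ?_⟩
  intro A n t hn ht h u hu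
  exact near_isometry_of_net (A.comp V.subtype) hn ht (S := S) hS'
    (fun x hx => h x (Finset.mem_image_of_mem _ hx)) ⟨u, hu⟩

end Nets

/-- Vectors supported on `T`. -/
def supportedOn {ι : Type*} (T : Finset ι) : Submodule ℝ (EuclideanSpace ℝ ι) where
  carrier := {u | ∀ j ∉ T, u j = 0}
  add_mem' := fun ha hb j hj => by simp [ha j hj, hb j hj]
  zero_mem' := fun j _ => by simp
  smul_mem' := fun c x hx j hj => by simp [hx j hj]

lemma finrank_supportedOn_le {ι : Type*} [Fintype ι] (T : Finset ι) :
    Module.finrank ℝ (supportedOn T) ≤ T.card := by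
  let f : supportedOn T →ₗ[ℝ] (T → ℝ) :=
    { toFun := fun u j => (u : EuclideanSpace ℝ ι) j
      map_add' := fun _ _ => rfl
      map_smul' := fun _ _ => rfl }
  have hf : Function.Injective f := by
    intro u v huv
    ext j
    by_cases hj : j ∈ T
    · exact congrFun huv ⟨j, hj⟩
    · rw [u.2 j hj, v.2 j hj]
  simpa using LinearMap.finrank_le_finrank_of_injective hf

/-- The design matrix as a linear map between Euclidean spaces. -/
noncomputable def designMap {n p : ℕ} (X : Fin n → Fin p → ℝ) :
    EuclideanSpace ℝ (Fin p) →ₗ[ℝ] EuclideanSpace ℝ (Fin n) :=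
  Matrix.toEuclideanLin (Matrix.of X)

lemma designMap_apply {n p : ℕ} (X : Fin n → Fin p → ℝ) (u : EuclideanSpace ℝ (Fin p))
    (i : Fin n) : designMap X u i = ∑ j, X i j * u j := rfl

lemma norm_designMap_sq {n p : ℕ} (X : Fin n → Fin p → ℝ) (u : EuclideanSpace ℝ (Fin p)) :
    ‖designMap X u‖ ^ 2 = ∑ i, (∑ j, X i j * u j) ^ 2 := by
  simp_rw [EuclideanSpace.real_norm_sq_eq, designMap_apply]

section GaussianVectors

variable {ι κ : Type*} [Fintype ι] [Fintype κ]

/-- A unit-norm linear combination of i.i.d. standard Gaussians is standard Gaussian. -/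
lemma map_sum_mul_pi_gaussianReal {u : ι → ℝ} (hu : ∑ j, u j ^ 2 = 1) :
    (Measure.pi fun _ : ι => gaussianReal 0 1).map (fun x => ∑ j, x j * u j) =
      gaussianReal 0 1 := by
  have h1 : (Measure.pi fun _ : ι => gaussianReal 0 1).map (fun x => ∑ j, x j * u j) =
      ((Measure.pi fun _ : ι => gaussianReal 0 1).map (fun x j => x j * u j)).map
        (fun x => ∑ j, x j) := by
    rw [Measure.map_map (by fun_prop) (by fun_prop)]; rfl
  rw [h1, Measure.pi_map_pi (f := fun j x => x * u j) (fun j => by fun_prop)]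
  apply Measure.ext_of_charFun
  have : ∀ j, IsProbabilityMeasure ((gaussianReal 0 1).map (fun x => x * u j)) :=
    fun j => Measure.isProbabilityMeasure_map (by fun_prop)
  rw [charFun_map_sum_pi_eq_prod]
  ext t
  simp_rw [Finset.prod_apply, gaussianReal_map_mul_const, charFun_gaussianReal]
  rw [← Complex.exp_sum]
  congr 1
  have hu' : ∑ j, (u j : ℂ) ^ 2 = 1 := by exact_mod_cast hu
  simp [← Finset.sum_div, ← Finset.sum_mul, hu']

/-- For a standard Gaussian matrix `X` and a unit vector `u`, `X u` is a standard Gaussian vector. -/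
lemma map_mulVec_pi_pi_gaussianReal {u : κ → ℝ} (hu : ∑ j, u j ^ 2 = 1) :
    (Measure.pi fun _ : ι => Measure.pi fun _ : κ => gaussianReal 0 1).map
        (fun X i => ∑ j, X i j * u j) = Measure.pi fun _ : ι => gaussianReal 0 1 := by
  have hp : IsProbabilityMeasure ((Measure.pi fun _ : κ => gaussianReal 0 1).map
      (fun x => ∑ j, x j * u j)) :=
    Measure.isProbabilityMeasure_map (Measurable.aemeasurable (by fun_prop))
  have hm : Measurable fun x : κ → ℝ => ∑ j, x j * u j := by fun_prop
  have h := Measure.pi_map_pi (μ := fun _ : ι => Measure.pi fun _ : κ => gaussianReal 0 1)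
    (f := fun _ x => ∑ j, x j * u j) (hμ := fun _ => inferInstance) (fun _ => hm.aemeasurable)
  simpa only [map_sum_mul_pi_gaussianReal hu] using h

/-- For a standard Gaussian matrix `X` and a unit vector `e`, `Xᵀ e` is a standard Gaussian
vector. -/
lemma map_vecMul_pi_pi_gaussianReal {e : ι → ℝ} (he : ∑ i, e i ^ 2 = 1) :
    (Measure.pi fun _ : ι => Measure.pi fun _ : κ => gaussianReal 0 1).map
        (fun X j => ∑ i, X i j * e i) = Measure.pi fun _ : κ => gaussianReal 0 1 := by
  have hm : Measurable fun (X : ι → κ → ℝ) j => ∑ i, X i j * e i := by fun_prop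
  have : IsProbabilityMeasure ((Measure.pi fun _ : ι => Measure.pi fun _ : κ =>
      gaussianReal 0 1).map (fun X j => ∑ i, X i j * e i)) :=
    Measure.isProbabilityMeasure_map hm.aemeasurable
  refine charFun_eq_pi_iff.1 fun t => ?_
  have hp : ∀ i, IsProbabilityMeasure ((Measure.pi fun _ : κ => gaussianReal 0 1).map
      (fun x => e i • WithLp.toLp 2 x)) :=
    fun i => Measure.isProbabilityMeasure_map (by fun_prop)
  have h1 : ((Measure.pi fun _ : ι => Measure.pi fun _ : κ =>
      gaussianReal 0 1).map (fun X j => ∑ i, X i j * e i)).map (WithLp.toLp 2) =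
      (Measure.pi fun i => (Measure.pi fun _ : κ => gaussianReal 0 1).map
      (fun x => e i • WithLp.toLp 2 x)).map (fun x => ∑ i, x i) := by
    rw [← Measure.pi_map_pi (f := fun i x => e i • WithLp.toLp 2 x) (fun j => by fun_prop),
      Measure.map_map (by fun_prop) (by fun_prop), Measure.map_map (by fun_prop) (by fun_prop)]
    congr 1
    ext X j
    simp [mul_comm]
  have h2 : ∀ i, (Measure.pi fun _ : κ => gaussianReal 0 1).map
      (fun x => e i • WithLp.toLp 2 x) = ((Measure.pi fun _ : κ => gaussianReal 0 1).map
      (WithLp.toLp 2)).map (fun x => e i • x) := by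
    intro i
    rw [Measure.map_map (by fun_prop) (by fun_prop)]; rfl
  rw [h1, charFun_map_sum_pi_eq_prod, Finset.prod_apply]
  simp_rw [h2, charFun_map_smul, charFun_pi, charFun_gaussianReal]
  simp_rw [← Complex.exp_sum]
  congr 1
  rw [Finset.sum_comm]
  refine Finset.sum_congr rfl fun j _ => ?_
  have he' : ∑ j, (e j : ℂ) ^ 2 = 1 := by exact_mod_cast he
  simp [← Finset.sum_div, ← Finset.sum_mul, he', mul_pow]

lemma lintegral_prod_pi_gaussianReal (s : Finset ι) {f : ℝ → ℝ≥0∞} (hf : Measurable f) :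
    ∫⁻ z, ∏ i ∈ s, f (z i) ∂(Measure.pi fun _ : ι => gaussianReal 0 1) =
      (∫⁻ x, f x ∂gaussianReal 0 1) ^ s.card := by
  have hind : iIndepFun (fun (i : ι) (z : ι → ℝ) => f (z i))
      (Measure.pi fun _ : ι => gaussianReal 0 1) :=
    iIndepFun_pi (X := fun _ => f) fun i => hf.aemeasurable
  rw [lintegral_prod_eq_prod_lintegral_of_indepFun s _ hind (fun i => by fun_prop),
    ← Finset.prod_const]
  refine Finset.prod_congr rfl fun i _ => ?_
  exact (measurePreserving_eval (fun _ : ι => gaussianReal 0 1) i).lintegral_comp hf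

/-- The moment generating function of a `χ²` variable with one degree of freedom. -/
lemma lintegral_exp_mul_sq_gaussianReal {l : ℝ} (hl : l < 1 / 2) :
    ∫⁻ x, ENNReal.ofReal (Real.exp (l * x ^ 2)) ∂gaussianReal 0 1 =
      ENNReal.ofReal ((Real.sqrt (1 - 2 * l))⁻¹) := by
  have hb : 0 < 1 / 2 - l := by linarith
  rw [gaussianReal_of_var_ne_zero _ one_ne_zero,
    lintegral_withDensity_eq_lintegral_mul _ (by fun_prop) (by fun_prop)]
  have h1 : ∀ x : ℝ, (gaussianPDF 0 1 * fun x => ENNReal.ofReal (Real.exp (l * x ^ 2))) x =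
      ENNReal.ofReal ((Real.sqrt (2 * Real.pi))⁻¹ * Real.exp (-(1 / 2 - l) * x ^ 2)) := by
    intro x
    rw [Pi.mul_apply, gaussianPDF, ← ENNReal.ofReal_mul (gaussianPDFReal_nonneg _ _ _),
      gaussianPDFReal, mul_assoc, ← Real.exp_add]
    congr 3
    · simp
    · simp; ring
  simp_rw [h1]
  rw [← ofReal_integral_eq_lintegral_ofReal
    ((integrable_exp_neg_mul_sq hb).const_mul _) (ae_of_all _ fun x => by positivity),
    integral_const_mul, integral_gaussian]
  congr 1
  rw [← Real.sqrt_inv, ← Real.sqrt_inv, ← Real.sqrt_mul (by positivity)]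
  congr 1
  have := Real.pi_pos.ne'
  have h2 : 1 - 2 * l ≠ 0 := by linarith
  field_simp

lemma lintegral_exp_mul_sum_sq (s : Finset ι) {l : ℝ} (hl : l < 1 / 2) :
    ∫⁻ z, ENNReal.ofReal (Real.exp (l * ∑ i ∈ s, z i ^ 2))
        ∂(Measure.pi fun _ : ι => gaussianReal 0 1) =
      ENNReal.ofReal ((Real.sqrt (1 - 2 * l))⁻¹ ^ s.card) := by
  have h1 : ∀ z : ι → ℝ, ENNReal.ofReal (Real.exp (l * ∑ i ∈ s, z i ^ 2)) =
      ∏ i ∈ s, ENNReal.ofReal (Real.exp (l * z i ^ 2)) := by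
    intro z
    rw [Finset.mul_sum, Real.exp_sum, ENNReal.ofReal_prod_of_nonneg fun i _ => by positivity]
  simp_rw [h1]
  rw [lintegral_prod_pi_gaussianReal s (f := fun x => ENNReal.ofReal (Real.exp (l * x ^ 2)))
    (by fun_prop), lintegral_exp_mul_sq_gaussianReal hl, ENNReal.ofReal_pow (by positivity)]

/-- Chernoff's bound. -/
lemma measure_le_of_lintegral_exp_le {Ω : Type*} [MeasurableSpace Ω] {μ : Measure Ω}
    {f : Ω → ℝ} (hf : Measurable f) {a K : ℝ}
    (h : ∫⁻ x, ENNReal.ofReal (Real.exp (f x)) ∂μ ≤ ENNReal.ofReal K) :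
    μ {x | a ≤ f x} ≤ ENNReal.ofReal (K * Real.exp (-a)) := by
  have h1 := mul_meas_ge_le_lintegral (μ := μ)
    (f := fun x => ENNReal.ofReal (Real.exp (f x))) (by fun_prop) (ENNReal.ofReal (Real.exp a))
  have h2 : {x | a ≤ f x} ⊆
      {x | ENNReal.ofReal (Real.exp a) ≤ ENNReal.ofReal (Real.exp (f x))} := by
    intro x hx
    exact ENNReal.ofReal_le_ofReal (Real.exp_le_exp.2 hx)
  rw [Real.exp_neg, ← div_eq_mul_inv, ENNReal.ofReal_div_of_pos (Real.exp_pos a)]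
  rw [ENNReal.le_div_iff_mul_le (by simp [Real.exp_pos]) (by simp), mul_comm]
  exact (mul_le_mul_right (measure_mono h2) _).trans (h1.trans h)

/-- Upper tail of `χ²`. -/
lemma measure_sum_sq_ge_le (s : Finset ι) {l : ℝ} (hl0 : 0 < l) (hl : l < 1 / 2) (a : ℝ) :
    (Measure.pi fun _ : ι => gaussianReal 0 1) {z | a ≤ ∑ i ∈ s, z i ^ 2} ≤
      ENNReal.ofReal ((Real.sqrt (1 - 2 * l))⁻¹ ^ s.card * Real.exp (-(l * a))) := by
  have h := measure_le_of_lintegral_exp_le (a := l * a) (by fun_prop)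
    (lintegral_exp_mul_sum_sq s hl).le
  refine (measure_mono fun z hz => ?_).trans h
  exact mul_le_mul_of_nonneg_left hz hl0.le

lemma inv_sqrt_one_sub_le {l : ℝ} (h : |l| ≤ 1 / 4) :
    (Real.sqrt (1 - 2 * l))⁻¹ ≤ Real.exp (l + 2 * l ^ 2) := by
  obtain ⟨h1, h2⟩ := abs_le.1 h
  have h0 : 0 < 1 - 2 * l := by linarith
  have key : (1 - 2 * l)⁻¹ ≤ Real.exp (2 * l + 4 * l ^ 2) := by
    rcases le_total 0 l with hl | hl
    · refine le_trans ?_ (Real.quadratic_le_exp_of_nonneg (by positivity))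
      rw [inv_le_iff_one_le_mul₀ h0]
      nlinarith [sq_nonneg l, mul_nonneg (sq_nonneg l) (by linarith : 0 ≤ 1 / 4 - l),
        mul_nonneg (mul_nonneg (sq_nonneg l) hl) (by linarith : 0 ≤ 1 / 4 - l),
        mul_nonneg (mul_nonneg (sq_nonneg l) (sq_nonneg l)) (by linarith : 0 ≤ 1 / 4 - l)]
    · have h3 : |(-(2 * l + 4 * l ^ 2))| ≤ 1 := by
        rw [abs_le]; constructor <;> nlinarith
      have h4 := (abs_le.1 (Real.abs_exp_sub_one_sub_id_le h3)).2
      rw [Real.exp_neg] at h4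
      have h5 : (Real.exp (2 * l + 4 * l ^ 2))⁻¹ ≤ 1 - 2 * l := by
        nlinarith [mul_nonneg (sq_nonneg l) (by linarith : 0 ≤ -l),
          mul_nonneg (mul_nonneg (sq_nonneg l) (by linarith : 0 ≤ -l))
            (by linarith : 0 ≤ 1 / 4 + l)]
      exact inv_le_of_inv_le₀ (Real.exp_pos _) h5
  rw [← Real.sqrt_inv]
  refine Real.sqrt_le_iff.2 ⟨by positivity, key.trans (le_of_eq ?_)⟩
  rw [← Real.exp_nat_mul]; congr 1; push_cast; ring

/-- Concentration of `χ²`. -/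
lemma measure_abs_sum_sq_sub_card_ge_le {t : ℝ} (ht0 : 0 ≤ t) (ht1 : t ≤ 1) :
    (Measure.pi fun _ : ι => gaussianReal 0 1)
        {z | Fintype.card ι * t ≤ |∑ i, z i ^ 2 - Fintype.card ι|} ≤
      ENNReal.ofReal (2 * Real.exp (-(Fintype.card ι * t ^ 2 / 8))) := by
  set n : ℝ := (Fintype.card ι : ℝ) with hn
  have main : ∀ l : ℝ, |l| ≤ 1 / 4 → ∀ a : ℝ, (Measure.pi fun _ : ι => gaussianReal 0 1)
      {z | a ≤ l * ∑ i, z i ^ 2} ≤ ENNReal.ofReal (Real.exp (n * (l + 2 * l ^ 2) - a)) := by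
    intro l hl a
    have hl' : l < 1 / 2 := by linarith [(abs_le.1 hl).2]
    refine (measure_le_of_lintegral_exp_le (a := a) (by fun_prop)
      (lintegral_exp_mul_sum_sq Finset.univ hl').le).trans (ENNReal.ofReal_le_ofReal ?_)
    rw [sub_eq_add_neg (n * _), Real.exp_add]
    gcongr
    rw [hn, Real.exp_nat_mul, Finset.card_univ]
    gcongr
    exact inv_sqrt_one_sub_le hl
  have h1 := main (t / 4) (by rw [abs_of_nonneg (by positivity)]; linarith) (t / 4 * (n * (1 + t)))
  have h2 := main (-(t / 4)) (by rw [abs_neg, abs_of_nonneg (by positivity)]; linarith)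
    (-(t / 4) * (n * (1 - t)))
  have e1 : n * (t / 4 + 2 * (t / 4) ^ 2) - t / 4 * (n * (1 + t)) = -(n * t ^ 2 / 8) := by ring
  have e2 : n * (-(t / 4) + 2 * (-(t / 4)) ^ 2) - -(t / 4) * (n * (1 - t)) =
    -(n * t ^ 2 / 8) := by ring
  rw [e1] at h1
  rw [e2] at h2
  rw [two_mul, ENNReal.ofReal_add (by positivity) (by positivity)]
  refine (measure_mono fun z hz => ?_).trans
    ((measure_union_le _ _).trans (add_le_add h1 h2))
  have ht4 : 0 ≤ t / 4 := by positivity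
  rcases le_abs.1 (show n * t ≤ |∑ i, z i ^ 2 - n| from hz) with h | h
  · left
    have h' : n * (1 + t) ≤ ∑ i, z i ^ 2 := by linarith
    exact mul_le_mul_of_nonneg_left h' ht4
  · right
    have := mul_le_mul_of_nonneg_left (by linarith : ∑ i, z i ^ 2 ≤ n * (1 - t))
      ht4
    change -(t / 4) * (n * (1 - t)) ≤ -(t / 4) * ∑ i, z i ^ 2
    linarith

end GaussianVectors

section Events

variable {n p : ℕ}

/-- Concentration of `‖X x‖²` for a standard Gaussian matrix. -/
lemma measure_near_isometry_at_compl_le {t : ℝ} (ht0 : 0 ≤ t) (ht1 : t ≤ 1)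
    (x : EuclideanSpace ℝ (Fin p)) :
    (Measure.pi fun _ : Fin n => Measure.pi fun _ : Fin p => gaussianReal 0 1)
      {X | ¬ |‖designMap X x‖ ^ 2 - n * ‖x‖ ^ 2| ≤ n * t * ‖x‖ ^ 2} ≤
      ENNReal.ofReal (2 * Real.exp (-(n * t ^ 2 / 8))) := by
  rcases eq_or_ne x 0 with rfl | hx
  · simp
  have hx' : 0 < ‖x‖ := norm_pos_iff.2 hx
  have hu : ∑ j, (x j / ‖x‖) ^ 2 = 1 := by
    simp_rw [div_pow, ← Finset.sum_div, ← EuclideanSpace.real_norm_sq_eq]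
    field_simp
  have h := measure_abs_sum_sq_sub_card_ge_le (ι := Fin n) ht0 ht1
  rw [Fintype.card_fin, ← map_mulVec_pi_pi_gaussianReal (ι := Fin n) hu] at h
  refine le_trans (le_trans (measure_mono ?_) (Measure.le_map_apply
    (Measurable.aemeasurable (by fun_prop)) _)) h
  intro X hX
  have hX' : n * t * ‖x‖ ^ 2 < |‖designMap X x‖ ^ 2 - n * ‖x‖ ^ 2| := not_le.1 hX
  change n * t ≤ |∑ i, (∑ j, X i j * (x j / ‖x‖)) ^ 2 - n|
  have h1 : ∑ i, (∑ j, X i j * (x j / ‖x‖)) ^ 2 = ‖designMap X x‖ ^ 2 / ‖x‖ ^ 2 := by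
    rw [norm_designMap_sq, Finset.sum_div]
    refine Finset.sum_congr rfl fun i _ => ?_
    rw [← div_pow, Finset.sum_div]
    simp_rw [mul_div_assoc]
  have h2 : ‖designMap X x‖ ^ 2 / ‖x‖ ^ 2 - n =
      (‖designMap X x‖ ^ 2 - n * ‖x‖ ^ 2) / ‖x‖ ^ 2 := by
    field_simp
  rw [h1, h2, abs_div, abs_of_nonneg (sq_nonneg ‖x‖), le_div_iff₀ (by positivity)]
  exact hX'.le

/-- The restricted isometry property at a fixed support. -/
lemma measure_near_isometry_compl_le {t : ℝ} (ht0 : 0 ≤ t) (ht1 : t ≤ 1) (T : Finset (Fin p)) :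
    (Measure.pi fun _ : Fin n => Measure.pi fun _ : Fin p => gaussianReal 0 1)
      {X | ¬ ∀ u ∈ supportedOn T,
        |‖designMap X u‖ ^ 2 - n * ‖u‖ ^ 2| ≤ n * (4 * t) * ‖u‖ ^ 2} ≤
      ENNReal.ofReal (25 ^ T.card * (2 * Real.exp (-(n * t ^ 2 / 8)))) := by
  obtain ⟨S, hS, hS'⟩ := exists_finset_near_isometry (F := EuclideanSpace ℝ (Fin n))
    (supportedOn T)
  have hcard : (S.card : ℝ) ≤ 25 ^ T.card := by
    exact_mod_cast hS.trans (Nat.pow_le_pow_right (by norm_num) (finrank_supportedOn_le T))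
  set μ := Measure.pi fun _ : Fin n => Measure.pi fun _ : Fin p => gaussianReal 0 1 with hμ
  calc _ ≤ μ (⋃ x ∈ S, {X | ¬ |‖designMap X x‖ ^ 2 - n * ‖x‖ ^ 2| ≤ n * t * ‖x‖ ^ 2}) := by
        refine measure_mono fun X hX => ?_
        by_contra hcon
        simp only [Set.mem_iUnion, not_exists, Set.mem_ofPred_eq, not_not] at hcon
        exact hX (hS' (designMap X) n t (Nat.cast_nonneg n) ht0 hcon)
    _ ≤ ∑ x ∈ S, ENNReal.ofReal (2 * Real.exp (-(n * t ^ 2 / 8))) :=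
        (measure_biUnion_finset_le _ _).trans
          (Finset.sum_le_sum fun x _ => measure_near_isometry_at_compl_le ht0 ht1 x)
    _ ≤ _ := by
        rw [Finset.sum_const, nsmul_eq_mul, ENNReal.ofReal_mul (p := 25 ^ T.card) (by positivity)]
        gcongr
        rw [← ENNReal.ofReal_natCast]
        exact ENNReal.ofReal_le_ofReal hcard

lemma measure_restricted_isometry_compl_le {t : ℝ} (ht0 : 0 ≤ t) (ht1 : t ≤ 1) {N : ℕ}
    (hN : N ≤ p) :
    (Measure.pi fun _ : Fin n => Measure.pi fun _ : Fin p => gaussianReal 0 1)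
      {X | ¬ ∀ T : Finset (Fin p), T.card ≤ N → ∀ u ∈ supportedOn T,
        |‖designMap X u‖ ^ 2 - n * ‖u‖ ^ 2| ≤ n * (4 * t) * ‖u‖ ^ 2} ≤
      ENNReal.ofReal (p.choose N * (25 ^ N * (2 * Real.exp (-(n * t ^ 2 / 8))))) := by
  set μ := Measure.pi fun _ : Fin n => Measure.pi fun _ : Fin p => gaussianReal 0 1 with hμ
  calc _ ≤ μ (⋃ T ∈ Finset.powersetCard N (Finset.univ : Finset (Fin p)),
        {X | ¬ ∀ u ∈ supportedOn T,
          |‖designMap X u‖ ^ 2 - n * ‖u‖ ^ 2| ≤ n * (4 * t) * ‖u‖ ^ 2}) := by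
        refine measure_mono fun X hX => ?_
        by_contra hcon
        simp only [Set.mem_iUnion, not_exists, Set.mem_ofPred_eq, not_not] at hcon
        refine hX fun T hT u hu => ?_
        obtain ⟨T', hTT', hT'⟩ := Finset.exists_superset_card_eq hT (by simpa using hN)
        exact hcon T' (by simpa using hT') u fun j hj => hu j fun h => hj (hTT' h)
    _ ≤ ∑ T ∈ Finset.powersetCard N (Finset.univ : Finset (Fin p)),
          ENNReal.ofReal (25 ^ N * (2 * Real.exp (-(n * t ^ 2 / 8)))) := by
        refine (measure_biUnion_finset_le _ _).trans (Finset.sum_le_sum fun T hT => ?_)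
        have := measure_near_isometry_compl_le (n := n) ht0 ht1 T
        rwa [(Finset.mem_powersetCard.1 hT).2] at this
    _ = _ := by
        rw [Finset.sum_const, nsmul_eq_mul, Finset.card_powersetCard, Finset.card_univ,
          Fintype.card_fin, ENNReal.ofReal_mul (p := (p.choose N : ℝ)) (by positivity),
          ENNReal.ofReal_natCast]

/-- Tail bound for the correlation of the noise with a fixed set of columns. -/
lemma measure_sum_sq_corr_gt_le (T : Finset (Fin p)) {l : ℝ} (hl0 : 0 < l) (hl : l < 1 / 2)
    (a : ℝ) :
    ((Measure.pi fun _ : Fin n => Measure.pi fun _ : Fin p => gaussianReal 0 1).prod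
      (Measure.pi fun _ : Fin n => gaussianReal 0 1))
      {w | (∑ i, w.2 i ^ 2) * a < ∑ j ∈ T, (∑ i, w.1 i j * w.2 i) ^ 2} ≤
      ENNReal.ofReal ((Real.sqrt (1 - 2 * l))⁻¹ ^ T.card * Real.exp (-(l * a))) := by
  have hmeas : MeasurableSet {w : (Fin n → Fin p → ℝ) × (Fin n → ℝ) |
      (∑ i, w.2 i ^ 2) * a < ∑ j ∈ T, (∑ i, w.1 i j * w.2 i) ^ 2} :=
    measurableSet_lt (by fun_prop) (by fun_prop)
  rw [Measure.prod_apply_symm hmeas]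
  set B := ENNReal.ofReal ((Real.sqrt (1 - 2 * l))⁻¹ ^ T.card * Real.exp (-(l * a))) with hB
  have hpt : ∀ e : Fin n → ℝ,
      (Measure.pi fun _ : Fin n => Measure.pi fun _ : Fin p => gaussianReal 0 1)
        {X | (∑ i, e i ^ 2) * a < ∑ j ∈ T, (∑ i, X i j * e i) ^ 2} ≤ B := by
    intro e
    set r := ∑ i, e i ^ 2 with hr
    have hr0 : 0 ≤ r := Finset.sum_nonneg fun i _ => sq_nonneg (e i)
    rcases hr0.eq_or_lt with h0 | h0
    · have he : ∀ i, e i = 0 := by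
        intro i
        have := (Finset.sum_eq_zero_iff_of_nonneg fun i _ => sq_nonneg (e i)).1 h0.symm i
          (Finset.mem_univ i)
        simpa using this
      simp [← h0, he]
    · have hs : 0 < Real.sqrt r := Real.sqrt_pos.2 h0
      have hu : ∑ i, (e i / Real.sqrt r) ^ 2 = 1 := by
        simp_rw [div_pow, Real.sq_sqrt h0.le, ← Finset.sum_div]
        exact div_self h0.ne'
      have h := measure_sum_sq_ge_le T hl0 hl a
      rw [← map_vecMul_pi_pi_gaussianReal (κ := Fin p) hu] at h
      refine le_trans (le_trans (measure_mono ?_) (Measure.le_map_apply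
        (Measurable.aemeasurable (by fun_prop)) _)) h
      intro X hX
      change a ≤ ∑ j ∈ T, (∑ i, X i j * (e i / Real.sqrt r)) ^ 2
      have h1 : ∑ j ∈ T, (∑ i, X i j * (e i / Real.sqrt r)) ^ 2 =
          (∑ j ∈ T, (∑ i, X i j * e i) ^ 2) / r := by
        rw [Finset.sum_div]
        refine Finset.sum_congr rfl fun j _ => ?_
        simp_rw [← mul_div_assoc, ← Finset.sum_div, div_pow, Real.sq_sqrt h0.le]
      rw [h1, le_div_iff₀ h0, mul_comm]
      exact le_of_lt hX
  calc _ ≤ ∫⁻ _, B ∂(Measure.pi fun _ : Fin n => gaussianReal 0 1) :=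
        lintegral_mono fun e => hpt e
    _ = B := by simp

/-- Uniform tail bound for the correlation of the noise with sets of columns. -/
lemma measure_exists_sum_sq_corr_gt_le {N : ℕ} {l : ℝ} (hl0 : 0 < l) (hl : l < 1 / 2)
    (a : ℕ → ℝ) :
    ((Measure.pi fun _ : Fin n => Measure.pi fun _ : Fin p => gaussianReal 0 1).prod
      (Measure.pi fun _ : Fin n => gaussianReal 0 1))
      {w | ∃ T : Finset (Fin p), 1 ≤ T.card ∧ T.card ≤ N ∧
        (∑ i, w.2 i ^ 2) * a T.card < ∑ j ∈ T, (∑ i, w.1 i j * w.2 i) ^ 2} ≤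
      ENNReal.ofReal (∑ m ∈ Finset.Icc 1 N,
        p.choose m * ((Real.sqrt (1 - 2 * l))⁻¹ ^ m * Real.exp (-(l * a m)))) := by
  set μ := ((Measure.pi fun _ : Fin n => Measure.pi fun _ : Fin p => gaussianReal 0 1).prod
      (Measure.pi fun _ : Fin n => gaussianReal 0 1)) with hμ
  set D : Finset (Fin p) → Set ((Fin n → Fin p → ℝ) × (Fin n → ℝ)) := fun T =>
    {w | (∑ i, w.2 i ^ 2) * a T.card < ∑ j ∈ T, (∑ i, w.1 i j * w.2 i) ^ 2} with hD
  calc _ ≤ μ (⋃ m ∈ Finset.Icc 1 N,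
        ⋃ T ∈ Finset.powersetCard m (Finset.univ : Finset (Fin p)), D T) := by
        refine measure_mono ?_
        rintro w ⟨T, h1, h2, h3⟩
        simp only [Set.mem_iUnion]
        exact ⟨T.card, Finset.mem_Icc.2 ⟨h1, h2⟩, T, by simp, h3⟩
    _ ≤ ∑ m ∈ Finset.Icc 1 N, ∑ T ∈ Finset.powersetCard m (Finset.univ : Finset (Fin p)),
        ENNReal.ofReal ((Real.sqrt (1 - 2 * l))⁻¹ ^ m * Real.exp (-(l * a m))) := by
        refine (measure_biUnion_finset_le _ _).trans (Finset.sum_le_sum fun m _ => ?_)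
        refine (measure_biUnion_finset_le _ _).trans (Finset.sum_le_sum fun T hT => ?_)
        have := measure_sum_sq_corr_gt_le (n := n) T hl0 hl (a T.card)
        simpa only [hμ, hD, (Finset.mem_powersetCard.1 hT).2] using this
    _ = _ := by
        rw [ENNReal.ofReal_sum_of_nonneg fun m _ => by positivity]
        refine Finset.sum_congr rfl fun m _ => ?_
        rw [Finset.sum_const, nsmul_eq_mul, Finset.card_powersetCard, Finset.card_univ,
          Fintype.card_fin, ENNReal.ofReal_mul (p := (p.choose m : ℝ)) (by positivity),
          ENNReal.ofReal_natCast]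

end Events

section Regression

open scoped RealInnerProductSpace

variable {n p : ℕ}

lemma mem_suppF {β : Fin p → ℝ} {j : Fin p} : j ∈ suppF β ↔ β j ≠ 0 := by
  simp [suppF]

lemma card_suppF_le {s : ℕ} {β : Fin p → ℝ} (h : β ∈ SparseV p s) : (suppF β).card ≤ s := by
  have h' : {j | β j ≠ 0}.ncard ≤ s := h
  rwa [suppF, ← Set.ncard_eq_toFinset_card]

/-- Restriction of a vector to a set of coordinates. -/
noncomputable def restrictTo (T : Finset (Fin p)) (v : Fin p → ℝ) : EuclideanSpace ℝ (Fin p) :=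
  WithLp.toLp 2 fun j => if j ∈ T then v j else 0

lemma restrictTo_apply (T : Finset (Fin p)) (v : Fin p → ℝ) (j : Fin p) :
    restrictTo T v j = if j ∈ T then v j else 0 := rfl

lemma restrictTo_mem (T : Finset (Fin p)) (v : Fin p → ℝ) : restrictTo T v ∈ supportedOn T :=
  fun j hj => by simp [restrictTo_apply, hj]

lemma norm_restrictTo (T : Finset (Fin p)) (v : Fin p → ℝ) :
    ‖restrictTo T v‖ = Real.sqrt (∑ j ∈ T, v j ^ 2) := by
  rw [EuclideanSpace.norm_eq]
  congr 1
  simp [restrictTo_apply, ite_pow, apply_ite, Finset.sum_ite_mem]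

lemma supportedOn_mono {S T : Finset (Fin p)} (h : S ⊆ T) : supportedOn S ≤ supportedOn T :=
  fun _ hu j hj => hu j fun hjS => hj (h hjS)

lemma inner_eq_zero_of_disjoint {S T : Finset (Fin p)} (h : Disjoint S T)
    {u v : EuclideanSpace ℝ (Fin p)} (hu : u ∈ supportedOn S) (hv : v ∈ supportedOn T) :
    ⟪u, v⟫ = 0 := by
  rw [PiLp.inner_apply]
  refine Finset.sum_eq_zero fun j _ => ?_
  by_cases hj : j ∈ S
  · simp [hv j (Finset.disjoint_left.1 h hj)]
  · simp [hu j hj]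

lemma inner_designMap_le (X : Fin n → Fin p → ℝ) (e : EuclideanSpace ℝ (Fin n))
    {T : Finset (Fin p)} {g : ℝ} (hg : 0 ≤ g)
    (h : ∑ j ∈ T, (∑ i, X i j * e i) ^ 2 ≤ g ^ 2) {d : EuclideanSpace ℝ (Fin p)}
    (hd : d ∈ supportedOn T) : ⟪e, designMap X d⟫ ≤ g * ‖d‖ := by
  have h1 : ⟪e, designMap X d⟫ = ∑ j ∈ T, (∑ i, X i j * e i) * d j := by
    have h2 : ∑ j ∈ T, (∑ i, X i j * e i) * d j = ∑ j, (∑ i, X i j * e i) * d j :=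
      Finset.sum_subset (Finset.subset_univ T) fun j _ hj => by simp [hd j hj]
    rw [h2, PiLp.inner_apply]
    simp only [designMap_apply, RCLike.inner_apply, conj_trivial, Finset.sum_mul]
    rw [Finset.sum_comm]
    exact Finset.sum_congr rfl fun i _ => Finset.sum_congr rfl fun j _ => by ring
  have h3 : ∑ j ∈ T, d j ^ 2 ≤ ‖d‖ ^ 2 := by
    rw [EuclideanSpace.real_norm_sq_eq]
    exact Finset.sum_le_sum_of_subset_of_nonneg (Finset.subset_univ T)
      fun _ _ _ => sq_nonneg _
  refine le_of_sq_le_sq ?_ (by positivity)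
  rw [h1, mul_pow]
  refine (Finset.sum_mul_sq_le_sq_mul_sq _ _ _).trans ?_
  exact mul_le_mul h h3 (Finset.sum_nonneg fun _ _ => sq_nonneg _) (sq_nonneg _)

lemma sum_sq_residual_eq (X : Fin n → Fin p → ℝ) (y : Fin n → ℝ) (θ : Fin p → ℝ) :
    ∑ i, (y i - ∑ j, X i j * θ j) ^ 2 =
      ‖WithLp.toLp 2 y - designMap X (WithLp.toLp 2 θ)‖ ^ 2 := by
  rw [EuclideanSpace.real_norm_sq_eq]
  rfl

lemma RSS_le (X : Fin n → Fin p → ℝ) (y : Fin n → ℝ) {ξ : Finset (Fin p)}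
    {b : EuclideanSpace ℝ (Fin p)} (hb : b ∈ supportedOn ξ) :
    RSS X y ξ ≤ ‖WithLp.toLp 2 y - designMap X b‖ ^ 2 := by
  refine csInf_le ⟨0, ?_⟩ ⟨b, hb, sum_sq_residual_eq X y b⟩
  rintro _ ⟨θ, -, rfl⟩
  exact Finset.sum_nonneg fun _ _ => sq_nonneg _

lemma le_RSS (X : Fin n → Fin p → ℝ) (y : Fin n → ℝ) {ξ : Finset (Fin p)} {c : ℝ}
    (h : ∀ b ∈ supportedOn ξ, c ≤ ‖WithLp.toLp 2 y - designMap X b‖ ^ 2) :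
    c ≤ RSS X y ξ := by
  refine le_csInf (Set.Nonempty.image _ ⟨0, fun _ _ => rfl⟩) ?_
  rintro _ ⟨θ, hθ, rfl⟩
  exact (h (WithLp.toLp 2 θ) hθ).trans_eq (sum_sq_residual_eq X y θ).symm

/-- Deterministic bound for the decrease of the residual sum of squares in the regression model. -/
lemma RSS_sub_RSS_le {X : Fin n → Fin p → ℝ} {e : Fin n → ℝ} {β : Fin p → ℝ}
    {ξ1 ξ2 : Finset (Fin p)} (hξ1 : ξ1 ⊆ suppF β) (hξ2 : Disjoint ξ2 (suppF β))
    {δ κ gs g2 R : ℝ} (hδ0 : 0 ≤ δ) (hκ : 0 < κ) (hκ2 : κ ^ 2 = n * (1 - δ))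
    (hrip : ∀ u ∈ supportedOn (suppF β ∪ ξ2),
      |‖designMap X u‖ ^ 2 - n * ‖u‖ ^ 2| ≤ n * δ * ‖u‖ ^ 2)
    (hgs0 : 0 ≤ gs) (hg20 : 0 ≤ g2)
    (hgs : ∑ j ∈ suppF β, (∑ i, X i j * e i) ^ 2 ≤ gs ^ 2)
    (hg2 : ∑ j ∈ ξ2, (∑ i, X i j * e i) ^ 2 ≤ g2 ^ 2)
    (hR0 : 0 ≤ R) (hR : n * (1 + δ) * ∑ j ∈ suppF β \ ξ1, β j ^ 2 ≤ R ^ 2) :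
    RSS X (fun i => (∑ j, X i j * β j) + e i) ξ1 -
      RSS X (fun i => (∑ j, X i j * β j) + e i) (ξ1 ∪ ξ2) ≤
      ((g2 + n * δ * ((R + gs / κ) / κ)) / κ) ^ 2 := by
  set y : Fin n → ℝ := fun i => (∑ j, X i j * β j) + e i with hy
  have hs1 : supportedOn (suppF β) ≤ supportedOn (suppF β ∪ ξ2) :=
    supportedOn_mono Finset.subset_union_left
  have hs2 : supportedOn ξ2 ≤ supportedOn (suppF β ∪ ξ2) :=
    supportedOn_mono Finset.subset_union_right
  have hbr : restrictTo (suppF β \ ξ1) β ∈ supportedOn (suppF β) :=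
    supportedOn_mono Finset.sdiff_subset (restrictTo_mem _ _)
  have hβ : restrictTo ξ1 β + restrictTo (suppF β \ ξ1) β = WithLp.toLp 2 β := by
    ext j
    simp only [PiLp.add_apply, restrictTo_apply, Finset.mem_sdiff, mem_suppF]
    by_cases h1 : j ∈ ξ1 <;> by_cases h2 : β j = 0 <;> simp [h1, h2]
  have hyeq : WithLp.toLp 2 y =
      designMap X (restrictTo ξ1 β + restrictTo (suppF β \ ξ1) β) + WithLp.toLp 2 e := by
    rw [hβ]; rfl
  have hRbr : ‖designMap X (restrictTo (suppF β \ ξ1) β)‖ ≤ R := by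
    refine le_of_sq_le_sq (le_trans ?_ hR) hR0
    have h1 := (abs_le.1 (hrip _ (hs1 hbr))).2
    rw [norm_restrictTo, Real.sq_sqrt (Finset.sum_nonneg fun _ _ => sq_nonneg _)] at h1
    linarith
  rw [sub_le_comm]
  refine le_RSS X y fun b hb => ?_
  have hbsplit : restrictTo ξ1 b + restrictTo (ξ2 \ ξ1) b = b := by
    ext j
    simp only [PiLp.add_apply, restrictTo_apply, Finset.mem_sdiff]
    by_cases h1 : j ∈ ξ1 <;> by_cases h2 : j ∈ ξ2 <;> simp [h1, h2]
    exact (hb j (by simp [h1, h2])).symm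
  obtain ⟨b', hb', h⟩ := exists_rss_difference_le (designMap X) hδ0 (Nat.cast_nonneg n) hκ hκ2
    (supportedOn_mono hξ1) (fun v hv u hu => inner_eq_zero_of_disjoint hξ2.symm hv hu)
    (fun v hv u hu => hrip _ (Submodule.add_mem _ (hs1 hv) (hs2 hu)))
    hgs0 hg20 (fun d hd => inner_designMap_le X (WithLp.toLp 2 e) hgs0 hgs hd)
    (fun d hd => inner_designMap_le X (WithLp.toLp 2 e) hg20 hg2 hd)
    (restrictTo_mem ξ1 β) hbr hRbr (restrictTo_mem ξ1 b)
    (supportedOn_mono Finset.sdiff_subset (restrictTo_mem (ξ2 \ ξ1) b))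
  rw [← hyeq, hbsplit] at h
  have h2 := RSS_le X y hb'
  linarith

end Regression

section Counting

lemma choose_le_exp {p m : ℕ} (hp : 1 ≤ p) (hm : 1 ≤ m) :
    (p.choose m : ℝ) ≤ Real.exp (m * (1 + Real.log ((p : ℝ) / m))) := by
  have hp' : (0 : ℝ) < p := by exact_mod_cast hp
  have hm' : (0 : ℝ) < m := by exact_mod_cast hm
  calc (p.choose m : ℝ) ≤ (p : ℝ) ^ m / m.factorial := Nat.choose_le_pow_div m p
    _ = ((p : ℝ) / m) ^ m * ((m : ℝ) ^ m / m.factorial) := by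
        rw [div_pow]; field_simp
    _ ≤ ((p : ℝ) / m) ^ m * Real.exp m := by
        gcongr
        exact Real.pow_div_factorial_le_exp _ hm'.le _
    _ = Real.exp (m * (1 + Real.log ((p : ℝ) / m))) := by
        rw [mul_add, mul_one, add_comm, Real.exp_add, Real.exp_nat_mul,
          Real.exp_log (by positivity)]

/-- Entropy of supports of size `N` and nets against the Gaussian deviation exponent. -/
lemma choose_mul_pow_mul_exp_le {p N s : ℕ} {C1 : ℝ} (hp : 1 ≤ p) (hs : 1 ≤ s) (hsN : s ≤ N)
    (hN : (N : ℝ) ≤ C1 * s) (hL : 1 ≤ Real.log ((p : ℝ) / s)) :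
    (p.choose N : ℝ) *
        (25 ^ N * (2 * Real.exp (-((6 * C1 + 1) * (s * Real.log ((p : ℝ) / s)))))) ≤
      2 * Real.exp (-Real.log ((p : ℝ) / s)) := by
  set L := Real.log ((p : ℝ) / s) with hLdef
  have hp' : (0 : ℝ) < p := by exact_mod_cast hp
  have hs' : (1 : ℝ) ≤ s := by exact_mod_cast hs
  have hsN' : (s : ℝ) ≤ N := by exact_mod_cast hsN
  have hLN : Real.log ((p : ℝ) / N) ≤ L := by
    apply Real.log_le_log (div_pos hp' (by linarith))
    gcongr
  have h25 : (25 : ℝ) ≤ Real.exp 4 := by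
    have h1 := Real.exp_one_gt_d9
    have : Real.exp 4 = Real.exp 1 ^ 4 := by rw [← Real.exp_nat_mul]; norm_num
    rw [this]
    calc (25 : ℝ) ≤ 2.5 ^ 4 := by norm_num
      _ ≤ _ := by gcongr; linarith
  calc _ ≤ Real.exp (N * (1 + L)) * (Real.exp 4 ^ N *
        (2 * Real.exp (-((6 * C1 + 1) * (s * L))))) := by
        gcongr
        refine (choose_le_exp hp (hs.trans hsN)).trans ?_
        gcongr
    _ = 2 * Real.exp (N * (1 + L) + N * 4 + -((6 * C1 + 1) * (s * L))) := by
        rw [Real.exp_add, Real.exp_add, Real.exp_nat_mul 4 N]; ring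
    _ ≤ 2 * Real.exp (-L) := by
        gcongr
        have h1 : (N : ℝ) * L ≤ C1 * s * L := by gcongr
        nlinarith

lemma sum_pow_le_two_mul {r : ℝ} (hr0 : 0 ≤ r) (hr : r ≤ 1 / 2) (N : ℕ) :
    ∑ m ∈ Finset.Icc 1 N, r ^ m ≤ 2 * r := by
  have h : ∑ m ∈ Finset.Icc 1 N, r ^ m ≤ 2 * r * (1 - r ^ N) := by
    induction N with
    | zero => simp
    | succ N ih =>
      rw [Finset.sum_Icc_succ_top (by lia)]
      have h1 : 0 ≤ r ^ (N + 1) := by positivity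
      have h2 : r ^ (N + 1) * r ≤ r ^ (N + 1) * (1 / 2) := by gcongr
      have h3 : r ^ (N + 1) = r ^ N * r := pow_succ r N
      nlinarith
  refine h.trans ?_
  have h1 : 0 ≤ r ^ N := by positivity
  nlinarith

lemma sum_choose_mul_le {p N s : ℕ} {C1 g lb c0 : ℝ} (hp : 1 ≤ p) (hs : 1 ≤ s)
    (hN : (N : ℝ) ≤ C1 * s) (hC1 : 0 < C1) (hg : 0 ≤ g) (hlb : lb = 1 + g) (hc0 : 0 ≤ c0)
    (hρ : c0 * Real.exp (1 - g * (Real.log ((p : ℝ) / s) - Real.log C1)) ≤ 1 / 2) :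
    ∑ m ∈ Finset.Icc 1 N, (p.choose m : ℝ) *
        (c0 ^ m * Real.exp (-(lb * (m * Real.log ((p : ℝ) / m))))) ≤
      2 * (c0 * Real.exp (1 - g * (Real.log ((p : ℝ) / s) - Real.log C1))) := by
  refine le_trans (Finset.sum_le_sum fun m hm => ?_) (sum_pow_le_two_mul (by positivity) hρ N)
  obtain ⟨hm1, hmN⟩ := Finset.mem_Icc.1 hm
  have hp' : (0 : ℝ) < p := by exact_mod_cast hp
  have hs' : (0 : ℝ) < s := by exact_mod_cast hs
  have hm' : (0 : ℝ) < m := by exact_mod_cast hm1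
  have hmN' : (m : ℝ) ≤ C1 * s := le_trans (by exact_mod_cast hmN) hN
  have hlog : Real.log ((p : ℝ) / s) - Real.log C1 ≤ Real.log ((p : ℝ) / m) := by
    rw [← Real.log_div (by positivity) hC1.ne', div_div, mul_comm (s : ℝ)]
    apply Real.log_le_log (by positivity)
    gcongr
  calc _ ≤ Real.exp (m * (1 + Real.log ((p : ℝ) / m))) *
        (c0 ^ m * Real.exp (-(lb * (m * Real.log ((p : ℝ) / m))))) := by
        gcongr
        exact choose_le_exp hp hm1
    _ = c0 ^ m * Real.exp (m * (1 - g * Real.log ((p : ℝ) / m))) := by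
        rw [mul_left_comm, ← Real.exp_add, hlb]
        ring_nf
    _ ≤ c0 ^ m * Real.exp (m * (1 - g * (Real.log ((p : ℝ) / s) - Real.log C1))) := by
        gcongr
    _ = _ := by rw [mul_pow, Real.exp_nat_mul]

lemma card_mul_log_le {p s q : ℕ} (hp : 1 ≤ p) (hq1 : 1 ≤ q) (hqs : q ≤ s)
    (hL : 1 ≤ Real.log ((p : ℝ) / s)) :
    q * Real.log ((p : ℝ) / q) ≤ s * Real.log ((p : ℝ) / s) := by
  have hp' : (0 : ℝ) < p := by exact_mod_cast hp
  have hq' : (0 : ℝ) < q := by exact_mod_cast hq1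
  have hqs' : (q : ℝ) ≤ s := by exact_mod_cast hqs
  have hs' : (0 : ℝ) < s := hq'.trans_le hqs'
  have h1 : Real.log ((p : ℝ) / q) = Real.log ((p : ℝ) / s) + Real.log ((s : ℝ) / q) := by
    rw [← Real.log_mul (by positivity) (by positivity)]
    congr 1
    field_simp
  have h2 : Real.log ((s : ℝ) / q) ≤ s / q - 1 := Real.log_le_sub_one_of_pos (by positivity)
  have h3 : q * Real.log ((s : ℝ) / q) ≤ s - q := by
    calc _ ≤ q * ((s : ℝ) / q - 1) := by gcongr
      _ = _ := by field_simp
  rw [h1]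
  nlinarith

end Counting

section GoodEvent

variable {n p s : ℕ}

lemma noise_correlation_bound_le {n δ δ0 K M b B D A : ℝ} (hn : 0 < n) (hδ0 : 0 ≤ δ) (hδ : δ ≤ δ0)
    (hδ3 : δ0 ≤ 1 / 3) (hK : δ = K * Real.sqrt (D / n)) (hM : 0 ≤ M)
    (hB : 0 ≤ B) (hbB : (1 + δ0) * b ≤ (1 - δ0) * B) (hD : 0 ≤ D) (hA : 0 ≤ A) :
    (Real.sqrt (n * (1 + δ0) * (b * A)) + n * δ * ((2 * M * Real.sqrt D +
        Real.sqrt (n * (1 + δ0) * (b * D)) / Real.sqrt (n * (1 - δ))) /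
          Real.sqrt (n * (1 - δ)))) / Real.sqrt (n * (1 - δ)) ≤
      2 * K * (2 * M + Real.sqrt B) * (D / Real.sqrt n) + Real.sqrt (B * A) := by
  have h1δ : 0 < 1 - δ := by linarith
  have hκ : 0 < Real.sqrt (n * (1 - δ)) := Real.sqrt_pos.2 (by positivity)
  have hκ2 : Real.sqrt (n * (1 - δ)) ^ 2 = n * (1 - δ) := Real.sq_sqrt (by positivity)
  set κ := Real.sqrt (n * (1 - δ)) with hκdef
  have hsqrt : ∀ x : ℝ, 0 ≤ x → Real.sqrt (n * (1 + δ0) * (b * x)) ≤ Real.sqrt (B * x) * κ := by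
    intro x hx
    rw [hκdef, ← Real.sqrt_mul (by positivity)]
    apply Real.sqrt_le_sqrt
    calc n * (1 + δ0) * (b * x) = n * x * ((1 + δ0) * b) := by ring
      _ ≤ n * x * ((1 - δ0) * B) := by gcongr
      _ ≤ n * x * ((1 - δ) * B) := by gcongr
      _ = _ := by ring
  have hA' := hsqrt A hA
  have hD' : Real.sqrt (n * (1 + δ0) * (b * D)) / κ ≤ Real.sqrt B * Real.sqrt D := by
    rw [div_le_iff₀ hκ, ← Real.sqrt_mul hB]
    exact hsqrt D hD
  have hsum : 2 * M * Real.sqrt D + Real.sqrt (n * (1 + δ0) * (b * D)) / κ ≤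
      (2 * M + Real.sqrt B) * Real.sqrt D := by linarith
  have hδκ : n * δ / κ ^ 2 ≤ 2 * δ := by
    rw [div_le_iff₀ (by positivity), hκ2]
    have : 0 ≤ n * δ * (1 - 2 * δ) := by
      apply mul_nonneg (by positivity); linarith
    nlinarith
  have hDn : Real.sqrt (D / n) * Real.sqrt D = D / Real.sqrt n := by
    rw [Real.sqrt_div hD, div_mul_eq_mul_div, Real.mul_self_sqrt hD]
  calc _ = Real.sqrt (n * (1 + δ0) * (b * A)) / κ + n * δ / κ ^ 2 *
        (2 * M * Real.sqrt D + Real.sqrt (n * (1 + δ0) * (b * D)) / κ) := by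
        field_simp
    _ ≤ Real.sqrt (B * A) + 2 * δ * ((2 * M + Real.sqrt B) * Real.sqrt D) := by
        gcongr
        rwa [div_le_iff₀ hκ]
    _ = Real.sqrt (B * A) + 2 * K * (2 * M + Real.sqrt B) * (Real.sqrt (D / n) * Real.sqrt D) := by
        rw [hK]; ring
    _ = _ := by rw [hDn]; ring

lemma RSS_sub_RSS_le_of_good_event {N : ℕ} {X : Fin n → Fin p → ℝ} {e : Fin n → ℝ}
    {β : Fin p → ℝ} (hβ : β ∈ SparseV p s) (hn : 1 ≤ n) (hp : 1 ≤ p)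
    (hL : 1 ≤ Real.log ((p : ℝ) / s)) {δ δ0 K M b B C : ℝ} (hδ0 : 0 ≤ δ) (hδ : δ ≤ δ0)
    (hδ3 : δ0 ≤ 1 / 3) (hK : δ = K * Real.sqrt (s * Real.log ((p : ℝ) / s) / n))
    (hM : 0 ≤ M) (hb : 0 ≤ b) (hB : 0 ≤ B) (hbB : (1 + δ0) * b ≤ (1 - δ0) * B)
    (hN : ∀ m : ℕ, (m : ℝ) ≤ C * s → s + m ≤ N)
    (hrip : ∀ T : Finset (Fin p), T.card ≤ N → ∀ u ∈ supportedOn T,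
      |‖designMap X u‖ ^ 2 - n * ‖u‖ ^ 2| ≤ n * δ * ‖u‖ ^ 2)
    (hcorr : ∀ T : Finset (Fin p), 1 ≤ T.card → T.card ≤ N → ∑ j ∈ T, (∑ i, X i j * e i) ^ 2 ≤
      (∑ i, e i ^ 2) * (b * (T.card * Real.log ((p : ℝ) / T.card))))
    (hnoise : ∑ i, e i ^ 2 ≤ n * (1 + δ0))
    {ξ1 : Finset (Fin p)} (hξ1 : ξ1 ⊆ suppF β)
    (hβξ : Real.sqrt (∑ j ∈ suppF β \ ξ1, β j ^ 2) ≤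
      M * Real.sqrt (s * Real.log ((p : ℝ) / s) / n))
    {ξ2 : Finset (Fin p)} (hξ2 : Disjoint ξ2 (suppF β)) (hξ20 : 0 < ξ2.card)
    (hξ2C : (ξ2.card : ℝ) ≤ C * s) :
    RSS X (fun i => (∑ j, X i j * β j) + e i) ξ1 -
      RSS X (fun i => (∑ j, X i j * β j) + e i) (ξ1 ∪ ξ2) ≤
      (2 * K * (2 * M + Real.sqrt B) *
          Real.sqrt ((s : ℝ) ^ 2 * (Real.log ((p : ℝ) / s)) ^ 2 / n) +
        Real.sqrt (B * ξ2.card * Real.log ((p : ℝ) / ξ2.card))) ^ 2 := by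
  have hn' : (0 : ℝ) < n := by exact_mod_cast hn
  set D : ℝ := s * Real.log ((p : ℝ) / s) with hDdef
  have hD : 0 ≤ D := by positivity
  have hm' : (0 : ℝ) < ξ2.card := by exact_mod_cast hξ20
  have hmp : (ξ2.card : ℝ) ≤ p := by
    have := Finset.card_le_univ ξ2
    rw [Fintype.card_fin] at this
    exact_mod_cast this
  set A : ℝ := ξ2.card * Real.log ((p : ℝ) / ξ2.card) with hAdef
  have hA : 0 ≤ A := mul_nonneg hm'.le (Real.log_nonneg ((one_le_div hm').2 hmp))
  have hcard : s + ξ2.card ≤ N := hN _ hξ2C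
  have hq := card_suppF_le hβ
  have hδ01 : 0 ≤ δ0 := hδ0.trans hδ
  have hnoise' : ∀ x : ℝ, 0 ≤ x → (∑ i, e i ^ 2) * (b * x) ≤
      Real.sqrt (n * (1 + δ0) * (b * x)) ^ 2 := by
    intro x hx
    rw [Real.sq_sqrt (by positivity)]
    gcongr
  have hgs : ∑ j ∈ suppF β, (∑ i, X i j * e i) ^ 2 ≤ Real.sqrt (n * (1 + δ0) * (b * D)) ^ 2 := by
    rcases Nat.eq_zero_or_pos (suppF β).card with h0 | h0
    · rw [Finset.card_eq_zero.1 h0]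
      simp only [Finset.sum_empty]
      positivity
    · refine ((hcorr _ h0 (by lia)).trans ?_).trans (hnoise' D hD)
      have he : 0 ≤ ∑ i, e i ^ 2 := Finset.sum_nonneg fun _ _ => sq_nonneg _
      have h1 := card_mul_log_le hp h0 hq hL
      gcongr
  have hg2 : ∑ j ∈ ξ2, (∑ i, X i j * e i) ^ 2 ≤ Real.sqrt (n * (1 + δ0) * (b * A)) ^ 2 :=
    (hcorr _ hξ20 (by lia)).trans (hnoise' A hA)
  have hR : n * (1 + δ) * ∑ j ∈ suppF β \ ξ1, β j ^ 2 ≤ (2 * M * Real.sqrt D) ^ 2 := by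
    have h1 : ∑ j ∈ suppF β \ ξ1, β j ^ 2 ≤ (M * Real.sqrt (D / n)) ^ 2 :=
      (Real.sqrt_le_left (by positivity)).1 hβξ
    rw [mul_pow, Real.sq_sqrt (by positivity)] at h1
    calc _ ≤ n * 4 * (M ^ 2 * (D / n)) := by gcongr; linarith
      _ = (2 * M * Real.sqrt D) ^ 2 := by
        rw [mul_pow, Real.sq_sqrt hD]; field_simp; ring
  have hmain := RSS_sub_RSS_le hξ1 hξ2 hδ0 (κ := Real.sqrt (n * (1 - δ)))
    (Real.sqrt_pos.2 (mul_pos hn' (by linarith)))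
    (Real.sq_sqrt (mul_nonneg hn'.le (by linarith)))
    (hrip _ ((Finset.card_union_le _ _).trans (by lia)))
    (Real.sqrt_nonneg _) (Real.sqrt_nonneg _) hgs hg2 (by positivity) hR
  refine hmain.trans (pow_le_pow_left₀ ?_ ?_ 2)
  · positivity
  · have h := noise_correlation_bound_le hn' hδ0 hδ hδ3 hK hM hB hbB hD hA
    have h2 : Real.sqrt ((s : ℝ) ^ 2 * (Real.log ((p : ℝ) / s)) ^ 2 / n) = D / Real.sqrt n := by
      rw [← mul_pow, Real.sqrt_div (sq_nonneg _), Real.sqrt_sq hD]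
    rw [h2, mul_assoc B]
    exact h

end GoodEvent

section FiniteSample

variable {n p s : ℕ}

lemma measure_not_RSS_bound_le {β : Fin p → ℝ} (hβ : β ∈ SparseV p s) (hn : 1 ≤ n) (hp : 1 ≤ p)
    (hs : 1 ≤ s) {C M b B δ0 l g K : ℝ} (hC : 0 < C) (hM : 0 ≤ M) (hb : 0 ≤ b) (hB : 0 ≤ B)
    (hbB : (1 + δ0) * b ≤ (1 - δ0) * B) (hδ00 : 0 ≤ δ0) (hδ3 : δ0 ≤ 1 / 3)
    (hl0 : 0 < l) (hl : l < 1 / 2) (hg : 0 ≤ g) (hlb : l * b = 1 + g)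
    (hK : K = 4 * Real.sqrt (8 * (6 * (C + 1) + 1)))
    (hL : 1 ≤ Real.log ((p : ℝ) / s)) (hLC : Real.log (C + 1) ≤ Real.log ((p : ℝ) / s))
    (hD : K * Real.sqrt (s * Real.log ((p : ℝ) / s) / n) ≤ δ0)
    (hρ : (Real.sqrt (1 - 2 * l))⁻¹ *
      Real.exp (1 - g * (Real.log ((p : ℝ) / s) - Real.log (C + 1))) ≤ 1 / 2) :
    ((Measure.pi fun _ : Fin n => Measure.pi fun _ : Fin p => gaussianReal 0 1).prod
      (Measure.pi fun _ : Fin n => gaussianReal 0 1))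
      {w | ¬ ∀ ξ1 : Finset (Fin p), ξ1 ⊆ suppF β →
        Real.sqrt (∑ j ∈ suppF β \ ξ1, β j ^ 2) ≤
          M * Real.sqrt (s * Real.log ((p : ℝ) / s) / n) →
        ∀ ξ2 : Finset (Fin p), Disjoint ξ2 (suppF β) → 0 < ξ2.card → (ξ2.card : ℝ) ≤ C * s →
          RSS w.1 (fun i => (∑ j, w.1 i j * β j) + w.2 i) ξ1 -
            RSS w.1 (fun i => (∑ j, w.1 i j * β j) + w.2 i) (ξ1 ∪ ξ2) ≤
          (2 * K * (2 * M + Real.sqrt B) *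
              Real.sqrt ((s : ℝ) ^ 2 * (Real.log ((p : ℝ) / s)) ^ 2 / n) +
            Real.sqrt (B * ξ2.card * Real.log ((p : ℝ) / ξ2.card))) ^ 2} ≤
      ENNReal.ofReal (2 * Real.exp (-Real.log ((p : ℝ) / s)) +
        2 * ((Real.sqrt (1 - 2 * l))⁻¹ *
          Real.exp (1 - g * (Real.log ((p : ℝ) / s) - Real.log (C + 1)))) +
        2 * Real.exp (-(n * δ0 ^ 2 / 8))) := by
  have hn' : (0 : ℝ) < n := by exact_mod_cast hn
  have hp' : (0 : ℝ) < p := by exact_mod_cast hp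
  have hs' : (0 : ℝ) < s := by exact_mod_cast hs
  set L := Real.log ((p : ℝ) / s) with hLdef
  set N : ℕ := s + ⌊C * s⌋₊ with hNdef
  have hN1 : (N : ℝ) ≤ (C + 1) * s := by
    have := Nat.floor_le (mul_pos hC hs').le
    rw [hNdef]
    push_cast
    linarith
  have hNp : N ≤ p := by
    have h1 : C + 1 ≤ (p : ℝ) / s := (Real.log_le_log_iff (by positivity) (by positivity)).1 hLC
    rw [le_div_iff₀ hs'] at h1
    exact_mod_cast hN1.trans h1
  set t : ℝ := Real.sqrt (8 * (6 * (C + 1) + 1)) * Real.sqrt (s * L / n) with ht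
  have ht4 : 4 * t = K * Real.sqrt (s * L / n) := by rw [hK, ht]; ring
  have ht0 : 0 ≤ t := by positivity
  have ht2 : n * t ^ 2 / 8 = (6 * (C + 1) + 1) * (s * L) := by
    rw [ht, mul_pow, Real.sq_sqrt (by positivity), Real.sq_sqrt (by positivity)]
    field_simp
  set μ := Measure.pi fun _ : Fin n => Measure.pi fun _ : Fin p => gaussianReal 0 1 with hμ
  set ν := Measure.pi fun _ : Fin n => gaussianReal 0 1 with hν
  set E1 : Set (Fin n → Fin p → ℝ) := {X | ¬ ∀ T : Finset (Fin p), T.card ≤ N →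
    ∀ u ∈ supportedOn T, |‖designMap X u‖ ^ 2 - n * ‖u‖ ^ 2| ≤ n * (4 * t) * ‖u‖ ^ 2} with hE1
  set E2 : Set ((Fin n → Fin p → ℝ) × (Fin n → ℝ)) := {w | ∃ T : Finset (Fin p), 1 ≤ T.card ∧
    T.card ≤ N ∧ (∑ i, w.2 i ^ 2) * (b * (T.card * Real.log ((p : ℝ) / T.card))) <
      ∑ j ∈ T, (∑ i, w.1 i j * w.2 i) ^ 2} with hE2
  set E3 : Set (Fin n → ℝ) := {e | n * δ0 ≤ |∑ i, e i ^ 2 - n|} with hE3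
  have h1 : (μ.prod ν) (E1 ×ˢ Set.univ) ≤ ENNReal.ofReal (2 * Real.exp (-L)) := by
    rw [Measure.prod_prod, measure_univ, mul_one]
    refine (measure_restricted_isometry_compl_le ht0 (by linarith) hNp).trans
      (ENNReal.ofReal_le_ofReal ?_)
    rw [ht2]
    exact choose_mul_pow_mul_exp_le hp hs (Nat.le_add_right _ _) hN1 hL
  have h2 : (μ.prod ν) E2 ≤ ENNReal.ofReal (2 * ((Real.sqrt (1 - 2 * l))⁻¹ *
      Real.exp (1 - g * (L - Real.log (C + 1))))) := by
    refine (measure_exists_sum_sq_corr_gt_le hl0 hl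
      fun m => b * (m * Real.log ((p : ℝ) / m))).trans (ENNReal.ofReal_le_ofReal ?_)
    simp_rw [← mul_assoc l b]
    exact sum_choose_mul_le hp hs hN1 (by linarith) hg hlb (by positivity) hρ
  have h3 : (μ.prod ν) (Set.univ ×ˢ E3) ≤
      ENNReal.ofReal (2 * Real.exp (-(n * δ0 ^ 2 / 8))) := by
    rw [Measure.prod_prod, measure_univ, one_mul]
    simpa only [Fintype.card_fin] using
      measure_abs_sum_sq_sub_card_ge_le (ι := Fin n) hδ00 (by linarith : δ0 ≤ 1)
  calc _ ≤ (μ.prod ν) (E1 ×ˢ Set.univ ∪ E2 ∪ Set.univ ×ˢ E3) := by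
        refine measure_mono fun w hw => ?_
        by_contra hcon
        simp only [Set.mem_union, Set.mem_prod, Set.mem_univ, and_true, true_and, not_or] at hcon
        obtain ⟨⟨hw1, hw2⟩, hw3⟩ := hcon
        replace hw3 : |∑ i, w.2 i ^ 2 - n| < n * δ0 := not_le.1 hw3
        refine hw fun ξ1 hξ1 hβξ ξ2 hξ2 hξ20 hξ2C => ?_
        refine RSS_sub_RSS_le_of_good_event hβ hn hp hL (by positivity) (ht4 ▸ hD) hδ3 ht4 hM hb hB
          hbB (N := N) ?_ (not_not.1 hw1) ?_ ?_ hξ1 hβξ hξ2 hξ20 hξ2C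
        · intro m hm
          exact Nat.add_le_add_left (Nat.le_floor hm) s
        · intro T hT1 hTN
          by_contra hcon
          exact hw2 ⟨T, hT1, hTN, not_le.1 hcon⟩
        · have := (abs_lt.1 hw3).2
          linarith
    _ ≤ _ := by
        refine (measure_union_le _ _).trans ?_
        rw [ENNReal.ofReal_add (by positivity) (by positivity),
          ENNReal.ofReal_add (by positivity) (by positivity)]
        gcongr
        exact (measure_union_le _ _).trans (add_le_add h1 h2)

end FiniteSample

section Asymptotics

lemma tendsto_tail_bound (c g a : ℝ) (hg : 0 < g) :
    Tendsto (fun L : ℝ => 2 * Real.exp (-L) + 2 * (c * Real.exp (1 - g * (L - a)))) atTop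
      (nhds 0) := by
  have h1 : Tendsto (fun L : ℝ => Real.exp (-L)) atTop (nhds 0) :=
    Real.tendsto_exp_neg_atTop_nhds_zero
  have h2 : Tendsto (fun L : ℝ => Real.exp (1 - g * (L - a))) atTop (nhds 0) := by
    refine Real.tendsto_exp_atBot.comp ?_
    refine tendsto_atBot_add_const_left atTop 1 (tendsto_neg_atTop_atBot.comp ?_)
    exact (tendsto_atTop_add_const_right atTop (-a) tendsto_id).const_mul_atTop hg
  simpa using (h1.const_mul 2).add ((h2.const_mul c).const_mul 2)

lemma measurable_designResponse {n p : ℕ} (β : Fin p → ℝ) :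
    Measurable fun Xe : (Fin n → Fin p → ℝ) × (Fin n → ℝ) =>
      (Xe.1, fun i => (∑ j, Xe.1 i j * β j) + Xe.2 i) := by fun_prop

instance (n p : ℕ) (β : Fin p → ℝ) : IsProbabilityMeasure (gaussDesign n p β) :=
  Measure.isProbabilityMeasure_map (measurable_designResponse β).aemeasurable

/-- Lower bound for the (outer) probability of a possibly nonmeasurable event. -/
lemma one_sub_le_gaussDesign {n p : ℕ} (β : Fin p → ℝ)
    (S : Set ((Fin n → Fin p → ℝ) × (Fin n → ℝ))) :
    1 - ((Measure.pi fun _ : Fin n => Measure.pi fun _ : Fin p => gaussianReal 0 1).prod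
      (Measure.pi fun _ : Fin n => gaussianReal 0 1))
        {w | ¬ (w.1, fun i => (∑ j, w.1 i j * β j) + w.2 i) ∈ S} ≤ gaussDesign n p β S := by
  refine le_trans ?_ (Measure.le_map_apply (measurable_designResponse β).aemeasurable S)
  set μ := (Measure.pi fun _ : Fin n => Measure.pi fun _ : Fin p => gaussianReal 0 1).prod
    (Measure.pi fun _ : Fin n => gaussianReal 0 1)
  set S' := (fun w : (Fin n → Fin p → ℝ) × (Fin n → ℝ) =>
    (w.1, fun i => (∑ j, w.1 i j * β j) + w.2 i)) ⁻¹' S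
  rw [tsub_le_iff_right]
  calc (1 : ℝ≥0∞) = μ (S' ∪ S'ᶜ) := by rw [Set.union_compl_self, measure_univ]
    _ ≤ _ := measure_union_le _ _

/-- A sequence of events whose complements have vanishing probability. -/
lemma tendsto_gaussDesign_one {pp : ℕ → ℕ} {β : ∀ k, Fin (pp k) → ℝ}
    {S : ∀ k, Set ((Fin k → Fin (pp k) → ℝ) × (Fin k → ℝ))}
    (h : ∀ r : ℝ, 0 < r → ∀ᶠ k in atTop,
      ((Measure.pi fun _ : Fin k => Measure.pi fun _ : Fin (pp k) => gaussianReal 0 1).prod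
        (Measure.pi fun _ : Fin k => gaussianReal 0 1))
        {w | ¬ (w.1, fun i => (∑ j, w.1 i j * β k j) + w.2 i) ∈ S k} ≤ ENNReal.ofReal r) :
    Tendsto (fun k => gaussDesign k (pp k) (β k) (S k)) atTop (nhds 1) := by
  have h0 : Tendsto (fun k =>
      ((Measure.pi fun _ : Fin k => Measure.pi fun _ : Fin (pp k) => gaussianReal 0 1).prod
        (Measure.pi fun _ : Fin k => gaussianReal 0 1))
        {w | ¬ (w.1, fun i => (∑ j, w.1 i j * β k j) + w.2 i) ∈ S k}) atTop (nhds 0) := by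
    refine ENNReal.tendsto_nhds_zero.2 fun ε hε => ?_
    obtain ⟨r, hr0, hrε⟩ := ENNReal.lt_iff_exists_nnreal_btwn.1 hε
    filter_upwards [h r (by exact_mod_cast hr0)] with k hk
    exact hk.trans (by simpa using hrε.le)
  have h1 := ENNReal.Tendsto.sub (tendsto_const_nhds (x := (1 : ℝ≥0∞))) h0
    (Or.inl ENNReal.one_ne_top)
  rw [tsub_zero] at h1
  exact tendsto_of_tendsto_of_tendsto_of_le_of_le h1 tendsto_const_nhds
    (fun k => one_sub_le_gaussDesign _ _) (fun k => prob_le_one)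

end Asymptotics

/-- Lemma 5 of the paper: under Gaussian random design with
`s_n log(p_n/s_n)/n → 0` and `s_n/p_n → 0`, for any constants `C, M > 0` and
tiny `ε' > 0` there is `C₀ > 0` such that, with probability tending to one,
uniformly for all `ξ₁ ⊆ ξ*` with `‖β_{ξ*∖ξ₁}‖ ≤ M √(s_n log(p_n/s_n)/n)` and
all nonempty `ξ₂ ⊆ (ξ*)ᶜ` with `|ξ₂| ≤ C s_n`:
`yᵀ(P_{ξ₁∪ξ₂} − P_{ξ₁})y ≤ [C₀ √(s_n² log²(p_n/s_n)/n) + √((2+ε')|ξ₂| log(p_n/|ξ₂|))]²`. -/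
theorem rss_difference_uniform_bound
    (pp s : ℕ → ℕ) (β : ∀ k : ℕ, Fin (pp k) → ℝ)
    (hsparse : ∀ k, β k ∈ SparseV (pp k) (s k))
    (hrate : Tendsto (fun k => s k * Real.log ((pp k : ℝ) / s k) / k) atTop (nhds 0))
    (hratio : Tendsto (fun k => (s k : ℝ) / pp k) atTop (nhds 0))
    (C M ε' : ℝ) (hC : 0 < C) (hM : 0 < M) (hε' : 0 < ε') :
    ∃ C0 > (0 : ℝ),
      Tendsto
        (fun k => gaussDesign k (pp k) (β k)
          {w | ∀ ξ1 : Finset (Fin (pp k)), ξ1 ⊆ suppF (β k) →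
            Real.sqrt (∑ j ∈ suppF (β k) \ ξ1, (β k j) ^ 2) ≤
              M * Real.sqrt (s k * Real.log ((pp k : ℝ) / s k) / k) →
            ∀ ξ2 : Finset (Fin (pp k)), Disjoint ξ2 (suppF (β k)) →
              0 < ξ2.card → (ξ2.card : ℝ) ≤ C * s k →
              RSS w.1 w.2 ξ1 - RSS w.1 w.2 (ξ1 ∪ ξ2) ≤
                (C0 * Real.sqrt ((s k : ℝ) ^ 2 * (Real.log ((pp k : ℝ) / s k)) ^ 2 / k)
                  + Real.sqrt ((2 + ε') * ξ2.card * Real.log ((pp k : ℝ) / ξ2.card))) ^ 2})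
        atTop (nhds 1) := by
  set b : ℝ := 2 + ε' / 2 with hb
  set δ0 : ℝ := ε' / (8 + 3 * ε') with hδ0
  set l : ℝ := 1 / (2 + ε' / 4) with hl
  set g : ℝ := l * b - 1 with hg
  set K : ℝ := 4 * Real.sqrt (8 * (6 * (C + 1) + 1)) with hK
  set c0 : ℝ := (Real.sqrt (1 - 2 * l))⁻¹ with hc0
  have hl0 : 0 < l := by positivity
  have hl2 : l < 1 / 2 := by
    rw [hl]
    exact one_div_lt_one_div_of_lt two_pos (by linarith)
  have hg0 : 0 < g := by
    rw [hg, hl, hb, one_div_mul_eq_div, sub_pos, one_lt_div (by positivity)]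
    linarith
  have hδ00 : 0 < δ0 := by positivity
  have hδ3 : δ0 ≤ 1 / 3 := by
    rw [hδ0, div_le_div_iff₀ (by positivity) (by norm_num)]
    linarith
  have hbB : (1 + δ0) * b ≤ (1 - δ0) * (2 + ε') := by
    have h : δ0 * (8 + 3 * ε') = ε' := by rw [hδ0]; field_simp
    rw [hb]
    nlinarith
  have hK0 : 0 < K := by positivity
  refine ⟨2 * K * (2 * M + Real.sqrt (2 + ε')), by positivity, ?_⟩
  refine tendsto_gaussDesign_one fun r hr => ?_
  obtain ⟨L0, hL0⟩ := eventually_atTop.1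
    ((tendsto_tail_bound c0 g (Real.log (C + 1)) hg0).eventually
      (gt_mem_nhds (lt_min (half_pos hr) one_pos)))
  set L1 : ℝ := max L0 (max 1 (Real.log (C + 1))) with hL1
  have hnoise : Tendsto (fun k : ℕ => 2 * Real.exp (-(k * δ0 ^ 2 / 8))) atTop (nhds 0) := by
    have h : Tendsto (fun k : ℕ => (k : ℝ) * (δ0 ^ 2 / 8)) atTop atTop :=
      tendsto_natCast_atTop_atTop.atTop_mul_const (by positivity)
    simpa [mul_div_assoc] using (Real.tendsto_exp_neg_atTop_nhds_zero.comp h).const_mul 2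
  have hsqrt : Tendsto (fun k => K * Real.sqrt (s k * Real.log ((pp k : ℝ) / s k) / k)) atTop
      (nhds 0) := by
    simpa using hrate.sqrt.const_mul K
  filter_upwards [hnoise.eventually (gt_mem_nhds (half_pos hr)),
    hsqrt.eventually (gt_mem_nhds hδ00), hratio.eventually (gt_mem_nhds (Real.exp_pos (-L1))),
    eventually_ge_atTop 1] with k hk1 hk2 hk3 hk4
  rcases Nat.eq_zero_or_pos (s k) with hs0 | hs0
  · refine (measure_mono_null (t := ∅) ?_ measure_empty).trans_le zero_le
    refine fun w hw => hw fun ξ1 _ _ ξ2 _ h1 h2 => ?_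
    rw [hs0, Nat.cast_zero, mul_zero] at h2
    exact absurd h2 (not_le.2 (by exact_mod_cast h1))
  rcases Nat.eq_zero_or_pos (pp k) with hp0 | hp0
  · refine (measure_mono_null (t := ∅) ?_ measure_empty).trans_le zero_le
    refine fun w hw => hw fun ξ1 _ _ ξ2 _ h1 _ => ?_
    have h2 := Finset.card_le_univ ξ2
    rw [Fintype.card_fin] at h2
    lia
  have hp' : (0 : ℝ) < pp k := by exact_mod_cast hp0
  have hs' : (0 : ℝ) < s k := by exact_mod_cast hs0
  have hL : L1 ≤ Real.log ((pp k : ℝ) / s k) := by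
    have h := Real.log_lt_log (by positivity) hk3
    rw [Real.log_exp, ← inv_div, Real.log_inv] at h
    linarith
  have htail := lt_min_iff.1 (hL0 _ ((le_max_left _ _).trans hL))
  have hexp := Real.exp_pos (-Real.log ((pp k : ℝ) / s k))
  refine (measure_not_RSS_bound_le (hsparse k) hk4 hp0 hs0 hC hM.le (by positivity) (by positivity)
    hbB hδ00.le hδ3 hl0 hl2 hg0.le (by rw [hg]; ring) hK
    (((le_max_left _ _).trans (le_max_right _ _)).trans hL)
    (((le_max_right _ _).trans (le_max_right _ _)).trans hL) hk2.le
    (by linarith [htail.2])).trans (ENNReal.ofReal_le_ofReal ?_)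
  linarith [htail.1]
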